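/- Let (R,𝔪) be a Noetherian local ring and M a finitely generated R-module of positive finiteness dimension t, with n_0 ≥ 1 such that 𝔪^{n_0} H^j_𝔪(M) = 0 for all j < t. Then for every filter regular sequence x_1,…,x_t on M contained in 𝔪^{2n_0}, there is an isomorphism (x_1,…,x_t)^{lim}_M / (x_1,…,x_t)M ≅ ⊕_{i=0}^{t-1} H^i_𝔪(M)^{⊕ C(t,i)}. -/

import Mathlib

universe u

open IsLocalRing

/-- The `i`-th local cohomology module `H^i_J(M)`. -/
noncomputable def lcoh {R : Type u} [CommRing R] (J : Ideal R) (i : ℕ)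
    (M : Type u) [AddCommGroup M] [Module R M] : ModuleCat.{u} R :=
  (localCohomology J i).obj (ModuleCat.of R M)

/-- `x` is a filter regular sequence on `M`. -/
def IsFilterRegularSeq {R : Type u} [CommRing R] (𝔪 : Ideal R)
    (M : Type u) [AddCommGroup M] [Module R M] {s : ℕ} (x : Fin s → R) : Prop :=
  ∀ i : Fin s, ∀ m : M,
    x i • m ∈ (Ideal.span (x '' {j | j < i}) • ⊤ : Submodule R M) →
      ∃ n : ℕ, ∀ r ∈ 𝔪 ^ n, r • m ∈ (Ideal.span (x '' {j | j < i}) • ⊤ : Submodule R M)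

/-- The limit closure of the sequence `x_1, …, x_t` in `M`. -/
def limitClosure {R : Type u} [CommRing R] {s : ℕ} (x : Fin s → R)
    (M : Type u) [AddCommGroup M] [Module R M] : Submodule R M :=
  ⨆ n : ℕ, (Ideal.span (Set.range fun i => x i ^ (n + 2)) • (⊤ : Submodule R M)).comap
    ((∏ i, x i) ^ (n + 1) • (LinearMap.id : M →ₗ[R] M))

namespace LC

open CategoryTheory CategoryTheory.Abelian

variable {R : Type u} [CommRing R]

/-- The module `R/J^n`. -/
noncomputable abbrev X (J : Ideal R) (n : ℕ) : ModuleCat.{u} R := ModuleCat.of R (R ⧸ J ^ n)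

/-- The projection `R/J^m → R/J^n`. -/
noncomputable def tr (J : Ideal R) {n m : ℕ} (h : n ≤ m) : X J m ⟶ X J n :=
  ModuleCat.ofHom (Submodule.mapQ _ _ LinearMap.id (Ideal.pow_le_pow_right h))

lemma tr_id (J : Ideal R) (n : ℕ) : tr J (le_refl n) = 𝟙 _ := by
  ext; simp [tr]

lemma tr_comp (J : Ideal R) {n m k : ℕ} (h : n ≤ m) (h' : m ≤ k) :
    tr J h' ≫ tr J h = tr J (h.trans h') := by
  ext; simp [tr]

/-- Transition maps on Ext. -/
noncomputable def trE (J : Ideal R) (M : ModuleCat.{u} R) (i : ℕ) (n m : ℕ) (h : n ≤ m) :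
    Ext (X J n) M i →ₗ[R] Ext (X J m) M i where
  toFun e := (Ext.mk₀ (tr J h)).comp e (zero_add i)
  map_add' := by simp
  map_smul' := by simp

instance (J : Ideal R) (M : ModuleCat.{u} R) (i : ℕ) :
    DirectedSystem (fun n => Ext (X J n) M i) (fun n m h => trE J M i n m h) where
  map_self n x := by simp [trE, tr_id]
  map_map i j k h h' x := by simp [trE, tr_comp]

/-- Local cohomology as a direct limit of Ext modules. -/
def HB (J : Ideal R) (i : ℕ) (M : ModuleCat.{u} R) : Type u :=
  Module.DirectLimit (fun n => Ext (X J n) M i) (trE J M i)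

noncomputable instance (J : Ideal R) (i : ℕ) (M : ModuleCat.{u} R) : AddCommGroup (HB J i M) :=
  inferInstanceAs (AddCommGroup (Module.DirectLimit (fun n => Ext (X J n) M i) (trE J M i)))

noncomputable instance (J : Ideal R) (i : ℕ) (M : ModuleCat.{u} R) : Module R (HB J i M) :=
  inferInstanceAs (Module R (Module.DirectLimit (fun n => Ext (X J n) M i) (trE J M i)))

/-- The canonical map from Ext to the limit. -/
noncomputable def inc (J : Ideal R) (i : ℕ) (M : ModuleCat.{u} R) (n : ℕ) :
    Ext (X J n) M i →ₗ[R] HB J i M :=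
  Module.DirectLimit.of R ℕ (fun n => Ext (X J n) M i) (trE J M i) n

lemma inc_surj (J : Ideal R) (i : ℕ) (M : ModuleCat.{u} R) (z : HB J i M) :
    ∃ n e, inc J i M n e = z := Module.DirectLimit.exists_of z

lemma inc_tr (J : Ideal R) (i : ℕ) (M : ModuleCat.{u} R) {n m : ℕ} (h : n ≤ m)
    (e : Ext (X J n) M i) :
    inc J i M m ((Ext.mk₀ (tr J h)).comp e (zero_add i)) = inc J i M n e :=
  Module.DirectLimit.of_f (f := trE J M i) (hij := h)

lemma inc_eq_zero (J : Ideal R) (i : ℕ) (M : ModuleCat.{u} R) {n : ℕ}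
    (e : Ext (X J n) M i) (he : inc J i M n e = 0) :
    ∃ m, ∃ h : n ≤ m, (Ext.mk₀ (tr J h)).comp e (zero_add i) = 0 :=
  Module.DirectLimit.of.zero_exact he

/-- The action of an Ext class. -/
noncomputable def op (J : Ideal R) {M N : ModuleCat.{u} R} {b : ℕ} (β : Ext M N b) (i c : ℕ)
    (h : i + b = c) : HB J i M →ₗ[R] HB J c N :=
  Module.DirectLimit.lift R ℕ _ _ (fun n => inc J c N n ∘ₗ
    { toFun := fun e => e.comp β h
      map_add' := by simp
      map_smul' := by simp }) (by
    intro n m hnm e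
    simp only [trE, LinearMap.coe_mk, AddHom.coe_mk, LinearMap.comp_apply]
    rw [Ext.comp_assoc _ _ _ (zero_add i) h (by omega), inc_tr])

@[simp] lemma op_inc (J : Ideal R) {M N : ModuleCat.{u} R} {b : ℕ} (β : Ext M N b) (i c : ℕ)
    (h : i + b = c) (n : ℕ) (e : Ext (X J n) M i) :
    op J β i c h (inc J i M n e) = inc J c N n (e.comp β h) := by
  exact Module.DirectLimit.lift_of _ _ _

section
variable (J : Ideal R) {M N P : ModuleCat.{u} R}

lemma op_comp {a b c : ℕ} (α : Ext M N a) (β : Ext N P b) (i j k : ℕ) (h : i + a = j)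
    (h' : j + b = k) (hc : a + b = c) (z : HB J i M) :
    op J β j k h' (op J α i j h z) = op J (α.comp β hc) i k (by omega) z := by
  obtain ⟨n, e, rfl⟩ := inc_surj J i M z
  simp only [op_inc]
  rw [Ext.comp_assoc _ _ _ h hc (by omega)]

lemma op_add {b : ℕ} (α β : Ext M N b) (i j : ℕ) (h : i + b = j) (z : HB J i M) :
    op J (α + β) i j h z = op J α i j h z + op J β i j h z := by
  obtain ⟨n, e, rfl⟩ := inc_surj J i M z
  simp

lemma op_smul {b : ℕ} (r : R) (α : Ext M N b) (i j : ℕ) (h : i + b = j) (z : HB J i M) :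
    op J (r • α) i j h z = r • op J α i j h z := by
  obtain ⟨n, e, rfl⟩ := inc_surj J i M z
  simp

lemma op_zero {b : ℕ} (i j : ℕ) (h : i + b = j) (z : HB J i M) :
    op J (0 : Ext M N b) i j h z = 0 := by
  obtain ⟨n, e, rfl⟩ := inc_surj J i M z
  simp

lemma op_id (i : ℕ) (z : HB J i M) : op J (Ext.mk₀ (𝟙 M)) i i rfl z = z := by
  obtain ⟨n, e, rfl⟩ := inc_surj J i M z
  simp

lemma op_ex1 {S : ShortComplex (ModuleCat.{u} R)} (hS : S.ShortExact) (i : ℕ)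
    (z : HB J (i + 1) S.X₁) (hz : op J (Ext.mk₀ S.f) (i + 1) (i + 1) rfl z = 0) :
    ∃ w, op J hS.extClass i (i + 1) rfl w = z := by
  obtain ⟨n, e, rfl⟩ := inc_surj J _ _ z
  rw [op_inc] at hz
  obtain ⟨m, h, hm⟩ := inc_eq_zero _ _ _ _ hz
  rw [← Ext.comp_assoc _ _ _ (zero_add (i+1)) (add_zero (i+1)) (by omega)] at hm
  obtain ⟨w, hw⟩ := Ext.covariant_sequence_exact₁ _ hS _ hm rfl
  exact ⟨inc J _ _ m w, by rw [op_inc, hw, inc_tr]⟩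

lemma op_ex2 {S : ShortComplex (ModuleCat.{u} R)} (hS : S.ShortExact) (i : ℕ)
    (z : HB J i S.X₂) (hz : op J (Ext.mk₀ S.g) i i rfl z = 0) :
    ∃ w, op J (Ext.mk₀ S.f) i i rfl w = z := by
  obtain ⟨n, e, rfl⟩ := inc_surj J _ _ z
  rw [op_inc] at hz
  obtain ⟨m, h, hm⟩ := inc_eq_zero _ _ _ _ hz
  rw [← Ext.comp_assoc _ _ _ (zero_add i) (add_zero i) (by omega)] at hm
  obtain ⟨w, hw⟩ := Ext.covariant_sequence_exact₂ _ hS _ hm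
  exact ⟨inc J _ _ m w, by rw [op_inc, hw, inc_tr]⟩

lemma op_ex3 {S : ShortComplex (ModuleCat.{u} R)} (hS : S.ShortExact) (i : ℕ)
    (z : HB J i S.X₃) (hz : op J hS.extClass i (i + 1) rfl z = 0) :
    ∃ w, op J (Ext.mk₀ S.g) i i rfl w = z := by
  obtain ⟨n, e, rfl⟩ := inc_surj J _ _ z
  rw [op_inc] at hz
  obtain ⟨m, h, hm⟩ := inc_eq_zero _ _ _ _ hz
  rw [← Ext.comp_assoc _ _ _ (zero_add i) rfl (by omega)] at hm
  obtain ⟨w, hw⟩ := Ext.covariant_sequence_exact₃ _ hS _ rfl hm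
  exact ⟨inc J _ _ m w, by rw [op_inc, hw, inc_tr]⟩

end

section unbundled

variable (J : Ideal R) (i : ℕ)
variable {A B C A' B' C' : Type u} [AddCommGroup A] [Module R A] [AddCommGroup B] [Module R B]
  [AddCommGroup C] [Module R C] [AddCommGroup A'] [Module R A'] [AddCommGroup B'] [Module R B']
  [AddCommGroup C'] [Module R C']

/-- Local cohomology, unbundled. -/
noncomputable abbrev H (M : Type u) [AddCommGroup M] [Module R M] : Type u := HB J i (ModuleCat.of R M)

/-- Functoriality. -/
noncomputable def Hmap (f : A →ₗ[R] B) : H J i A →ₗ[R] H J i B :=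
  op J (Ext.mk₀ (ModuleCat.ofHom f)) i i rfl

lemma Hmap_id (z : H J i A) : Hmap J i (LinearMap.id : A →ₗ[R] A) z = z := op_id J i z

lemma Hmap_comp (f : A →ₗ[R] B) (g : B →ₗ[R] C) (z : H J i A) :
    Hmap J i g (Hmap J i f z) = Hmap J i (g ∘ₗ f) z := by
  simp only [Hmap]
  rw [op_comp J _ _ _ _ _ _ _ (add_zero 0), Ext.mk₀_comp_mk₀]
  rfl

lemma Hmap_add (f g : A →ₗ[R] B) (z : H J i A) :
    Hmap J i (f + g) z = Hmap J i f z + Hmap J i g z := by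
  simp only [Hmap]
  rw [← op_add, ← Ext.mk₀_add]; rfl

lemma Hmap_smul (r : R) (f : A →ₗ[R] B) (z : H J i A) :
    Hmap J i (r • f) z = r • Hmap J i f z := by
  simp only [Hmap]
  rw [← op_smul, ← Ext.mk₀_smul]; rfl

lemma Hmap_zero (z : H J i A) : Hmap J i (0 : A →ₗ[R] B) z = 0 := by
  have := Hmap_smul J i 0 (0 : A →ₗ[R] B) z
  simpa using this

/-- The short complex of a short exact sequence. -/
noncomputable abbrev sc (f : A →ₗ[R] B) (g : B →ₗ[R] C) (hfg : Function.Exact f g) :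
    ShortComplex (ModuleCat.{u} R) :=
  ShortComplex.mk (ModuleCat.ofHom f) (ModuleCat.ofHom g) (by
    ext x; exact hfg.apply_apply_eq_zero x)

lemma sc_exact (f : A →ₗ[R] B) (g : B →ₗ[R] C) (hf : Function.Injective f)
    (hg : Function.Surjective g) (hfg : Function.Exact f g) : (sc f g hfg).ShortExact where
  exact := (ShortComplex.ShortExact.moduleCat_exact_iff_function_exact _).2 hfg
  mono_f := (ModuleCat.mono_iff_injective _).2 hf
  epi_g := (ModuleCat.epi_iff_surjective _).2 hg

/-- Connecting map. -/
noncomputable def Hδ (f : A →ₗ[R] B) (g : B →ₗ[R] C) (hf : Function.Injective f)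
    (hg : Function.Surjective g) (hfg : Function.Exact f g) : H J i C →ₗ[R] H J (i + 1) A :=
  op J (sc_exact f g hf hg hfg).extClass i (i + 1) rfl

variable {f : A →ₗ[R] B} {g : B →ₗ[R] C} (hf : Function.Injective f)
    (hg : Function.Surjective g) (hfg : Function.Exact f g)

include hf hg hfg in
lemma H_ex2 (z : H J i B) (hz : Hmap J i g z = 0) : ∃ w, Hmap J i f w = z :=
  op_ex2 J (sc_exact f g hf hg hfg) i z hz

lemma H_ex1 (z : H J (i + 1) A) (hz : Hmap J (i + 1) f z = 0) :
    ∃ w, Hδ J i f g hf hg hfg w = z :=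
  op_ex1 J (sc_exact f g hf hg hfg) i z hz

lemma H_ex3 (z : H J i C) (hz : Hδ J i f g hf hg hfg z = 0) :
    ∃ w, Hmap J i g w = z :=
  op_ex3 J (sc_exact f g hf hg hfg) i z hz

lemma Hδ_Hmap (z : H J i B) : Hδ J i f g hf hg hfg (Hmap J i g z) = 0 := by
  simp only [Hδ, Hmap]
  rw [op_comp J _ _ _ _ _ _ _ (zero_add 1)]
  erw [(sc_exact f g hf hg hfg).comp_extClass]
  rw [op_zero]

lemma Hmap_Hδ (z : H J i C) : Hmap J (i + 1) f (Hδ J i f g hf hg hfg z) = 0 := by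
  simp only [Hδ, Hmap]
  rw [op_comp J _ _ _ _ _ _ _ (add_zero 1)]
  erw [(sc_exact f g hf hg hfg).extClass_comp]
  rw [op_zero]

lemma Hδ_nat {f' : A' →ₗ[R] B'} {g' : B' →ₗ[R] C'} (hf' : Function.Injective f')
    (hg' : Function.Surjective g') (hfg' : Function.Exact f' g')
    (α : A →ₗ[R] A') (β : B →ₗ[R] B') (γ : C →ₗ[R] C') (h1 : β ∘ₗ f = f' ∘ₗ α)
    (h2 : γ ∘ₗ g = g' ∘ₗ β) (z : H J i C) :
    Hδ J i f' g' hf' hg' hfg' (Hmap J i γ z) = Hmap J (i + 1) α (Hδ J i f g hf hg hfg z) := by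
  simp only [Hδ, Hmap]
  rw [op_comp J _ _ _ _ _ _ _ (zero_add 1), op_comp J _ _ _ _ _ _ _ (add_zero 1)]
  let φ : sc f g hfg ⟶ sc f' g' hfg' :=
    { τ₁ := ModuleCat.ofHom α
      τ₂ := ModuleCat.ofHom β
      τ₃ := ModuleCat.ofHom γ
      comm₁₂ := by
        ext x; exact (LinearMap.congr_fun h1 x).symm
      comm₂₃ := by
        ext x; exact (LinearMap.congr_fun h2 x).symm }
  have := ShortComplex.ShortExact.extClass_naturality (sc_exact f g hf hg hfg)
    (sc_exact f' g' hf' hg' hfg') φ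
  rw [this]

end unbundled

end LC

namespace LC

open CategoryTheory CategoryTheory.Abelian

section compare

variable {R : Type u} [CommRing R]

section opp
variable (K : ChainComplex (ModuleCat.{u} R)ᵒᵖ ℕ) (n : ℕ)

lemma oc_surj (h : (K.homology n).unop) : ∃ c, (K.homologyι n).unop.hom c = h :=
  (ModuleCat.epi_iff_surjective _).1 (inferInstance : Epi (K.homologyι n).unop) h

lemma oc_inj : Function.Injective (K.pOpcycles n).unop.hom :=
  (ModuleCat.mono_iff_injective _).1 (inferInstance : Mono (K.pOpcycles n).unop)

lemma oc_d (c : (K.opcycles n).unop) : (K.d (n + 1) n).unop.hom ((K.pOpcycles n).unop.hom c) = 0 := by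
  have := K.d_pOpcycles (n + 1) n
  have h2 : (K.pOpcycles n).unop ≫ (K.d (n + 1) n).unop = 0 := by
    rw [← unop_comp, this]; rfl
  exact LinearMap.congr_fun (congrArg ModuleCat.Hom.hom h2) c

lemma oc_ex (f : (K.X n).unop) (hf : (K.d (n + 1) n).unop.hom f = 0) :
    ∃ c, (K.pOpcycles n).unop.hom c = f := by
  have e : (ShortComplex.mk _ _ (K.d_pOpcycles (n + 1) n)).Exact :=
    ShortComplex.exact_of_g_is_cokernel _ (K.opcyclesIsCokernel (n+1) n (by simp))
  have e2 := (ShortComplex.moduleCat_exact_iff _).1 e.unop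
  exact e2 f hf

lemma oc_ker (c : (K.opcycles n).unop) : (K.homologyι n).unop.hom c = 0 ↔
    ∃ g, (K.d n ((ComplexShape.down ℕ).next n)).unop.hom g = (K.pOpcycles n).unop.hom c := by
  have e : (ShortComplex.mk _ _ (K.homologyι_comp_fromOpcycles n ((ComplexShape.down ℕ).next n))).Exact :=
    ShortComplex.exact_of_f_is_kernel _ (K.homologyIsKernel n _ rfl)
  have e2 := (ShortComplex.moduleCat_exact_iff _).1 e.unop
  have e3 : (K.fromOpcycles n ((ComplexShape.down ℕ).next n)).unop ≫ (K.pOpcycles n).unop =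
      (K.d n ((ComplexShape.down ℕ).next n)).unop := by
    rw [← unop_comp, K.p_fromOpcycles]
  have e4 : (K.fromOpcycles n ((ComplexShape.down ℕ).next n)).unop ≫ (K.homologyι n).unop = 0 := by
    rw [← unop_comp, K.homologyι_comp_fromOpcycles]; rfl
  constructor
  · intro h
    obtain ⟨g, hg⟩ := e2 c h
    refine ⟨g, ?_⟩
    rw [← e3, ← hg]; rfl
  · rintro ⟨g, hg⟩
    rw [← e3] at hg
    have : (K.fromOpcycles n ((ComplexShape.down ℕ).next n)).unop.hom g = c := oc_inj K n hg
    rw [← this]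
    exact LinearMap.congr_fun (congrArg ModuleCat.Hom.hom e4) g

end opp

variable {A B : ModuleCat.{u} R} (P : ProjectiveResolution A) (n : ℕ)

lemma extMk_zero_iff' (f : P.complex.X n ⟶ B) (hf : P.complex.d (n + 1) n ≫ f = 0) :
    P.extMk f (n + 1) rfl hf = 0 ↔
      ∃ g : P.complex.X ((ComplexShape.down ℕ).next n) ⟶ B, P.complex.d n _ ≫ g = f := by
  cases n with
  | succ n =>
    rw [P.extMk_eq_zero_iff _ _ rfl hf n rfl]
    rw [show (ComplexShape.down ℕ).next (n + 1) = n from by simp]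
  | zero =>
    have h0 : P.complex.d 0 ((ComplexShape.down ℕ).next 0) = 0 := P.complex.shape _ _ (by simp)
    simp only [h0, Limits.zero_comp, exists_const]
    constructor
    · intro h
      simp only [← P.extEquivCohomologyClass.apply_eq_iff_eq,
        ProjectiveResolution.extEquivCohomologyClass_extMk,
        ProjectiveResolution.extEquivCohomologyClass_zero,
        CochainComplex.HomComplex.CohomologyClass.mk_eq_zero_iff] at h
      rw [CochainComplex.HomComplex.Cocycle.toSingleMk_mem_coboundaries_iff _ _ _ _ _ 1 (by simp)] at h
      obtain ⟨g, hg⟩ := h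
      have hz : Limits.IsZero (P.cochainComplex.X 1) :=
        P.cochainComplex.isZero_of_isStrictlyLE 0 1 (by simp)
      have : g = 0 := hz.eq_of_src _ _
      rw [this, Limits.comp_zero] at hg
      rw [← cancel_epi (P.cochainComplexXIso (-((0:ℕ):ℤ)) 0 rfl).hom, ← hg]
      simp
    · rintro h
      subst h
      simp

end compare
end LC

namespace LC

open CategoryTheory CategoryTheory.Abelian

section compare2

variable {R : Type u} [CommRing R]
variable {A A' : ModuleCat.{u} R} (P : ProjectiveResolution A) (P' : ProjectiveResolution A')
  (B : ModuleCat.{u} R) (n : ℕ)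

/-- The dual complex. -/
noncomputable abbrev Kc : ChainComplex (ModuleCat.{u} R)ᵒᵖ ℕ :=
  ((((linearYoneda R (ModuleCat.{u} R)).obj B).rightOp).mapHomologicalComplex _).obj P.complex

/-- underlying cocycle -/
noncomputable def coc (c : ((Kc P B).opcycles n).unop) : P.complex.X n ⟶ B :=
  ((Kc P B).pOpcycles n).unop.hom c

lemma coc_d (c : ((Kc P B).opcycles n).unop) : P.complex.d (n + 1) n ≫ coc P B n c = 0 :=
  oc_d (Kc P B) n c

lemma extMk_congr {f g : P.complex.X n ⟶ B} (h : f = g) (hf : P.complex.d (n + 1) n ≫ f = 0)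
   (hg : P.complex.d (n + 1) n ≫ g = 0) :
   P.extMk f (n+1) rfl hf = P.extMk g (n+1) rfl hg := by
  subst h; rfl

/-- To new Ext. -/
noncomputable def toNew : ((Kc P B).opcycles n).unop →ₗ[R] Ext A B n where
  toFun c := P.extMk (coc P B n c) (n + 1) rfl (coc_d P B n c)
  map_add' c c' := by
    rw [P.add_extMk]
    exact extMk_congr _ _ _ (map_add ((Kc P B).pOpcycles n).unop.hom c c') _ _
  map_smul' r c := by
    rw [RingHom.id_apply, Ext.smul_eq_comp_mk₀, P.extMk_comp_mk₀]
    refine extMk_congr _ _ _ ?_ _ _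
    refine (map_smul ((Kc P B).pOpcycles n).unop.hom r c).trans ?_
    rw [Linear.comp_smul, Category.comp_id]
    rfl

lemma toNew_surj : Function.Surjective (toNew P B n) := by
  intro e
  obtain ⟨f, hf, rfl⟩ := P.extMk_surjective e (n + 1) rfl
  obtain ⟨c, hc⟩ := oc_ex (Kc P B) n f hf
  exact ⟨c, extMk_congr _ _ _ (f := coc P B n c) hc (coc_d P B n c) hf⟩

lemma toNew_ker : LinearMap.ker (toNew P B n) = LinearMap.ker ((Kc P B).homologyι n).unop.hom := by
  ext c
  rw [LinearMap.mem_ker, LinearMap.mem_ker, oc_ker]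
  exact extMk_zero_iff' P n _ (coc_d P B n c)

/-- Comparison of Ext. -/
noncomputable def cmp : ((Kc P B).homology n).unop ≃ₗ[R] Ext A B n :=
  (LinearMap.quotKerEquivOfSurjective ((Kc P B).homologyι n).unop.hom (oc_surj (Kc P B) n)).symm ≪≫ₗ
  (Submodule.quotEquivOfEq _ _ (toNew_ker P B n).symm) ≪≫ₗ
  (LinearMap.quotKerEquivOfSurjective (toNew P B n) (toNew_surj P B n))

lemma cmp_apply (c : ((Kc P B).opcycles n).unop) :
    cmp P B n (((Kc P B).homologyι n).unop.hom c) = toNew P B n c := by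
  have h := LinearMap.quotKerEquivOfSurjective_symm_apply ((Kc P B).homologyι n).unop.hom
    (hf := oc_surj (Kc P B) n) c
  exact congrArg (fun w => (LinearMap.quotKerEquivOfSurjective (toNew P B n) (toNew_surj P B n))
    ((Submodule.quotEquivOfEq _ _ (toNew_ker P B n).symm) w)) h

lemma cmp_nat (g : A' ⟶ A) (φ : ProjectiveResolution.Hom P' P g) (h : ((Kc P B).homology n).unop) :
    cmp P' B n ((HomologicalComplex.homologyMap
      (((((linearYoneda R (ModuleCat.{u} R)).obj B).rightOp).mapHomologicalComplex _).map φ.hom) n).unop.hom h) =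
    (Ext.mk₀ g).comp (cmp P B n h) (zero_add n) := by
  obtain ⟨c, rfl⟩ := oc_surj (Kc P B) n h
  rw [cmp_apply]
  set ψ := (((((linearYoneda R (ModuleCat.{u} R)).obj B).rightOp).mapHomologicalComplex _).map φ.hom)
  have h1 : ((Kc P B).homologyι n).unop ≫ (HomologicalComplex.homologyMap ψ n).unop =
     (HomologicalComplex.opcyclesMap ψ n).unop ≫ ((Kc P' B).homologyι n).unop := by
    rw [← unop_comp, ← unop_comp, HomologicalComplex.homologyι_naturality]
  have h2 := LinearMap.congr_fun (congrArg ModuleCat.Hom.hom h1) c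
  have h3 : (HomologicalComplex.opcyclesMap ψ n).unop ≫ ((Kc P' B).pOpcycles n).unop = 
     ((Kc P B).pOpcycles n).unop ≫ (ψ.f n).unop := by
    rw [← unop_comp, ← unop_comp, HomologicalComplex.p_opcyclesMap]
  have h4 := LinearMap.congr_fun (congrArg ModuleCat.Hom.hom h3) c
  refine (congrArg (cmp P' B n) h2).trans ?_
  refine (cmp_apply P' B n _).trans ?_
  refine Eq.trans ?_ (ProjectiveResolution.mk₀_comp_extMk _ _ rfl (coc_d P B n c) φ).symm
  exact extMk_congr _ _ _ (f := coc P' B n _) (g := φ.hom.f n ≫ coc P B n c) h4 (coc_d P' B n _) (by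
    rw [← φ.hom.comm_assoc, coc_d, Limits.comp_zero])

/-- Comparison with the old Ext. -/
noncomputable def cmpOld (A B : ModuleCat.{u} R) (n : ℕ) :
    (((_root_.Ext R (ModuleCat.{u} R) n).obj (Opposite.op A)).obj B) ≃ₗ[R] Ext A B n :=
  ((projectiveResolution A).isoLeftDerivedObj
    ((linearYoneda R (ModuleCat.{u} R)).obj B).rightOp n).unop.symm.toLinearEquiv ≪≫ₗ
    cmp (projectiveResolution A) B n

lemma cmpOld_nat {A A' : ModuleCat.{u} R} (g : A' ⟶ A) (B : ModuleCat.{u} R) (n : ℕ)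
    (z : (((_root_.Ext R (ModuleCat.{u} R) n).obj (Opposite.op A)).obj B)) :
    cmpOld A' B n ((((_root_.Ext R (ModuleCat.{u} R) n).map g.op).app B).hom z) =
      (Ext.mk₀ g).comp (cmpOld A B n z) (zero_add n) := by
  let φ : ProjectiveResolution.Hom (projectiveResolution A') (projectiveResolution A) g :=
    { hom := ProjectiveResolution.lift g _ _
      hom_f_zero_comp_π_f_zero := by
        have := HomologicalComplex.congr_hom (ProjectiveResolution.lift_commutes g
          (projectiveResolution A') (projectiveResolution A)) 0
        rw [HomologicalComplex.comp_f, HomologicalComplex.comp_f,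
          ChainComplex.single₀_map_f_zero] at this
        exact this }
  have h1 := ProjectiveResolution.isoLeftDerivedObj_inv_naturality g (projectiveResolution A')
    (projectiveResolution A) φ.hom (by simpa using φ.hom_f_zero_comp_π_f_zero)
    ((linearYoneda R (ModuleCat.{u} R)).obj B).rightOp n
  have h2 := congrArg Quiver.Hom.unop h1
  have h3 := LinearMap.congr_fun (congrArg ModuleCat.Hom.hom h2) z
  have h4 := cmp_nat (projectiveResolution A) (projectiveResolution A') B n g φ
    ((((projectiveResolution A).isoLeftDerivedObj
    ((linearYoneda R (ModuleCat.{u} R)).obj B).rightOp n).unop.symm.toLinearEquiv) z)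
  refine Eq.trans ?_ h4
  exact congrArg (cmp (projectiveResolution A') B n) h3

end compare2
end LC

namespace LC

open CategoryTheory CategoryTheory.Abelian

section compare3

variable {R : Type u} [CommRing R] (J : Ideal R) (i : ℕ) (M : Type u) [AddCommGroup M] [Module R M]

/-- Evaluated diagram. -/
noncomputable abbrev evd : (ℕᵒᵖ)ᵒᵖ ⥤ ModuleCat.{u} R :=
  localCohomology.diagram (localCohomology.idealPowersDiagram J) i ⋙
    (evaluation _ _).obj (ModuleCat.of R M)

/-- Evaluated cocone. -/
noncomputable abbrev evc : Limits.Cocone (evd J i M) :=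
  ((evaluation _ _).obj (ModuleCat.of R M)).mapCocone
    (Limits.colimit.cocone (localCohomology.diagram (localCohomology.idealPowersDiagram J) i))

/-- It is a colimit. -/
noncomputable def evcl : Limits.IsColimit (evc J i M) :=
  Limits.isColimitOfPreserves ((evaluation _ _).obj (ModuleCat.of R M)) (Limits.colimit.isColimit _)

/-- the pieces of the comparison -/
noncomputable def cmpN (n : ℕ) : (evd J i M).obj (Opposite.op (Opposite.op n)) ≃ₗ[R]
    Ext (X J n) (ModuleCat.of R M) i := cmpOld (X J n) (ModuleCat.of R M) i

lemma cmpN_nat {n m : ℕ} (h : n ≤ m)  (z : (evd J i M).obj (Opposite.op (Opposite.op n))) :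
    cmpN J i M m (((evd J i M).map (homOfLE h).op.op).hom z) =
      trE J (ModuleCat.of R M) i n m h (cmpN J i M n z) :=
  cmpOld_nat (tr J h) (ModuleCat.of R M) i z

/-- Forward. -/
noncomputable def fwd : H J i M →ₗ[R] (evc J i M).pt :=
  Module.DirectLimit.lift R ℕ _ _ (fun n =>
    ((evc J i M).ι.app (Opposite.op (Opposite.op n))).hom ∘ₗ (cmpN J i M n).symm.toLinearMap) (by
    intro n m h e
    obtain ⟨z, rfl⟩ := (cmpN J i M n).surjective e
    rw [← cmpN_nat]
    simp only [LinearMap.comp_apply, LinearEquiv.coe_coe, LinearEquiv.symm_apply_apply]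
    have := (evc J i M).w (homOfLE h).op.op
    exact LinearMap.congr_fun (congrArg ModuleCat.Hom.hom this) z)

lemma fwd_inc (n : ℕ) (e) : fwd J i M (inc J i _ n e) =
    ((evc J i M).ι.app (Opposite.op (Opposite.op n))).hom ((cmpN J i M n).symm e) :=
  Module.DirectLimit.lift_of _ _ _

/-- Cocone for the backward map. -/
noncomputable def bcc : Limits.Cocone (evd J i M) where
  pt := ModuleCat.of R (H J i M)
  ι := { app := fun n => ModuleCat.ofHom (inc J i (ModuleCat.of R M) n.unop.unop ∘ₗ
                (cmpN J i M n.unop.unop).toLinearMap)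
         naturality := by
          intro n m f
          ext z
          have h : n.unop.unop ≤ m.unop.unop := leOfHom f.unop.unop
          have := cmpN_nat J i M h z
          refine (congrArg (inc J i (ModuleCat.of R M) m.unop.unop) this).trans ?_
          exact inc_tr J i (ModuleCat.of R M) h _ }

/-- Backward. -/
noncomputable def bwd : (evc J i M).pt →ₗ[R] H J i M := ((evcl J i M).desc (bcc J i M)).hom

lemma bwd_app (n : ℕ) (z) : bwd J i M (((evc J i M).ι.app (Opposite.op (Opposite.op n))).hom z) =
    inc J i _ n (cmpN J i M n z) :=
  LinearMap.congr_fun (congrArg ModuleCat.Hom.hom ((evcl J i M).fac (bcc J i M)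
    (Opposite.op (Opposite.op n)))) z

/-- Comparison with the evaluated colimit. -/
noncomputable def Hcmp0 : H J i M ≃ₗ[R] (evc J i M).pt :=
  LinearEquiv.ofLinearMap (fwd J i M) (bwd J i M) (by
    have : ModuleCat.ofHom (fwd J i M ∘ₗ bwd J i M) = 𝟙 (evc J i M).pt := by
      apply (evcl J i M).hom_ext
      intro n
      ext z
      refine (congrArg (fwd J i M) (bwd_app J i M n.unop.unop z)).trans ?_
      rw [fwd_inc]
      erw [LinearEquiv.symm_apply_apply]
      rfl
    exact congrArg ModuleCat.Hom.hom this) (by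
    ext z
    obtain ⟨n, e, rfl⟩ := inc_surj J i _ z
    rw [LinearMap.comp_apply, fwd_inc, bwd_app, LinearEquiv.apply_symm_apply]
    rfl)

/-- Comparison of local cohomologies. -/
noncomputable def Hcmp : H J i M ≃ₗ[R] lcoh J i M := Hcmp0 J i M

end compare3
end LC

namespace LC

open CategoryTheory CategoryTheory.Abelian

section ev

variable {R : Type u} [CommRing R] (J : Ideal R)
variable {M N : Type u} [AddCommGroup M] [Module R M] [AddCommGroup N] [Module R N]

/-- Evaluation at one. -/
noncomputable def evE (n : ℕ) (M : Type u) [AddCommGroup M] [Module R M] :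
    Ext (X J n) (ModuleCat.of R M) 0 →ₗ[R] M where
  toFun e := (Ext.homEquiv₀ e).hom (Ideal.Quotient.mk (J ^ n) 1)
  map_add' e e' := by
    change (Ext.addEquiv₀ (e + e')).hom _ = _
    rw [map_add]; rfl
  map_smul' r e := by
    obtain ⟨φ, rfl⟩ := Ext.homEquiv₀.symm.surjective e
    have : r • (Ext.homEquiv₀.symm φ : Ext (X J n) (ModuleCat.of R M) 0) =
      Ext.homEquiv₀.symm (r • φ) := by
      rw [Ext.homEquiv₀_symm_apply, Ext.homEquiv₀_symm_apply, Ext.mk₀_smul]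
    rw [this]
    simp only [Equiv.apply_symm_apply]
    rfl

lemma evE_mk₀ (n : ℕ) (φ : X J n ⟶ ModuleCat.of R M) :
    evE J n M (Ext.mk₀ φ) = φ.hom (Ideal.Quotient.mk (J ^ n) 1) := by
  change (Ext.homEquiv₀ (Ext.homEquiv₀.symm φ)).hom _ = _
  rw [Equiv.apply_symm_apply]

lemma ex_mk₀ {A B : ModuleCat.{u} R} (e : Ext A B 0) : ∃ φ, e = Ext.mk₀ φ :=
  ⟨_, (Ext.mk₀_homEquiv₀_apply e).symm⟩

/-- Evaluation of degree zero local cohomology. -/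
noncomputable def Hev : H J 0 M →ₗ[R] M :=
  Module.DirectLimit.lift R ℕ _ _ (fun n => evE J n M) (by
    intro n m h e
    obtain ⟨φ, rfl⟩ := ex_mk₀ e
    simp only [trE, LinearMap.coe_mk, AddHom.coe_mk, Ext.mk₀_comp_mk₀, evE_mk₀]
    rfl)

lemma Hev_inc (n : ℕ) (φ : X J n ⟶ ModuleCat.of R M) :
    Hev J (inc J 0 _ n (Ext.mk₀ φ)) = φ.hom (Ideal.Quotient.mk (J ^ n) 1) :=
  (Module.DirectLimit.lift_of _ _ _).trans (evE_mk₀ J n φ)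

lemma Hev_inj (z : H J 0 M) (hz : Hev J z = 0) : z = 0 := by
  obtain ⟨n, e, rfl⟩ := inc_surj J 0 _ z
  obtain ⟨φ, rfl⟩ := ex_mk₀ e
  rw [Hev_inc] at hz
  have : φ = 0 := by
    refine ModuleCat.hom_ext (LinearMap.ext fun x => ?_)
    obtain ⟨x, rfl⟩ := Ideal.Quotient.mk_surjective x
    have : Ideal.Quotient.mk (J ^ n) x = x • Ideal.Quotient.mk (J ^ n) 1 := by
      rw [← Ideal.Quotient.mk_eq_mk, ← Ideal.Quotient.mk_eq_mk, ← Submodule.Quotient.mk_smul]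
      simp
    rw [this, map_smul, hz]; simp
  rw [this]; simp

lemma Hev_nat (f : M →ₗ[R] N) (z : H J 0 M) : Hev J (Hmap J 0 f z) = f (Hev J z) := by
  obtain ⟨n, e, rfl⟩ := inc_surj J 0 _ z
  obtain ⟨φ, rfl⟩ := ex_mk₀ e
  rw [Hmap, op_inc, Ext.mk₀_comp_mk₀, Hev_inc, Hev_inc]
  rfl

/-- Torsion elements. -/
def IsTor (m : M) : Prop := ∃ k : ℕ, ∀ r ∈ J ^ k, r • m = 0

lemma Hev_tor (z : H J 0 M) : IsTor J (Hev J z) := by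
  obtain ⟨n, e, rfl⟩ := inc_surj J 0 _ z
  obtain ⟨φ, rfl⟩ := ex_mk₀ e
  refine ⟨n, fun r hr => ?_⟩
  rw [Hev_inc, ← map_smul, ← Ideal.Quotient.mk_eq_mk, ← Submodule.Quotient.mk_smul]
  have : Submodule.Quotient.mk (p := J ^ n) (r • (1:R)) = 0 := by
    rw [Submodule.Quotient.mk_eq_zero]; simpa using hr
  erw [this]; simp

lemma Hev_surj (m : M) (hm : IsTor J m) : ∃ z, Hev J z = m := by
  obtain ⟨n, hn⟩ := hm
  refine ⟨inc J 0 _ n (Ext.mk₀ (ModuleCat.ofHom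
    (Submodule.liftQ (J ^ n) (LinearMap.toSpanSingleton R M m) (fun r hr => hn r hr)))), ?_⟩
  rw [Hev_inc]
  change (LinearMap.toSpanSingleton R M m) 1 = m
  simp

end ev
end LC

namespace LC

open CategoryTheory CategoryTheory.Abelian

section torsion

variable {R : Type u} [CommRing R] (J : Ideal R)
variable {A B C A' B' C' : Type u} [AddCommGroup A] [Module R A] [AddCommGroup B] [Module R B]
  [AddCommGroup C] [Module R C] [AddCommGroup A'] [Module R A'] [AddCommGroup B'] [Module R B']
  [AddCommGroup C'] [Module R C']

lemma kill_helper {f : A →ₗ[R] B} {g : B →ₗ[R] C} (hf : Function.Injective f)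
    (hg : Function.Surjective g) (hfg : Function.Exact f g)
    {f' : A' →ₗ[R] B'} {g' : B' →ₗ[R] C'} (hf' : Function.Injective f')
    (hg' : Function.Surjective g') (hfg' : Function.Exact f' g')
    (α : A' →ₗ[R] A) (β : B' →ₗ[R] B) (γ : C' →ₗ[R] C) (h1 : β ∘ₗ f' = f ∘ₗ α)
    (h2 : γ ∘ₗ g' = g ∘ₗ β) {T : ModuleCat.{u} R} {i : ℕ} (e : Ext (ModuleCat.of R A) T i)
    (he : (Ext.mk₀ (ModuleCat.ofHom α)).comp e (zero_add i) = 0) :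
    (Ext.mk₀ (ModuleCat.ofHom γ)).comp
      ((sc_exact f g hf hg hfg).extClass.comp e (add_comm 1 i)) (zero_add (i + 1)) = 0 := by
  let φ : sc f' g' hfg' ⟶ sc f g hfg :=
    { τ₁ := ModuleCat.ofHom α
      τ₂ := ModuleCat.ofHom β
      τ₃ := ModuleCat.ofHom γ
      comm₁₂ := by
        ext x; exact (LinearMap.congr_fun h1 x).symm
      comm₂₃ := by
        ext x; exact (LinearMap.congr_fun h2 x).symm }
  have := ShortComplex.ShortExact.extClass_naturality (sc_exact f' g' hf' hg' hfg')
    (sc_exact f g hf hg hfg) φ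
  rw [← Ext.comp_assoc _ _ _ (zero_add 1) (add_comm 1 i) (by omega)]
  erw [← this]
  rw [Ext.comp_assoc _ _ _ (add_zero 1) (zero_add i) (by omega)]
  erw [he]
  simp

lemma kill_mono {L L' L'' : ModuleCat.{u} R} (a : L ⟶ L') (b : L' ⟶ L'') {T : ModuleCat.{u} R} {i : ℕ}
    (e : Ext L'' T i) (he : (Ext.mk₀ b).comp e (zero_add i) = 0) :
    (Ext.mk₀ (a ≫ b)).comp e (zero_add i) = 0 := by
  rw [← Ext.mk₀_comp_mk₀, Ext.comp_assoc _ _ _ (zero_add 0) (zero_add i) (by omega), he]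
  simp

lemma kill_sub (α : A' →ₗ[R] A) (N : Submodule R A) (hα : ∀ x, α x ∈ N) {T : ModuleCat.{u} R}
    {i : ℕ} (e : Ext (ModuleCat.of R A) T i)
    (he : (Ext.mk₀ (ModuleCat.ofHom N.subtype)).comp e (zero_add i) = 0) :
    (Ext.mk₀ (ModuleCat.ofHom α)).comp e (zero_add i) = 0 := by
  have h : ModuleCat.ofHom α = ModuleCat.ofHom (LinearMap.codRestrict N α hα) ≫
      ModuleCat.ofHom N.subtype := rfl
  rw [h]
  exact kill_mono (ModuleCat.ofHom (LinearMap.codRestrict N α hα)) _ e he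

lemma kill_both {f : A →ₗ[R] B} {g : B →ₗ[R] C} (hf : Function.Injective f)
    (hg : Function.Surjective g) (hfg : Function.Exact f g)
    {f' : A' →ₗ[R] B'} {g' : B' →ₗ[R] C'} (hf' : Function.Injective f')
    (hg' : Function.Surjective g') (hfg' : Function.Exact f' g')
    (α : A' →ₗ[R] A) (β : B' →ₗ[R] B) (γ : C' →ₗ[R] C) (h1 : β ∘ₗ f' = f ∘ₗ α)
    (h2 : γ ∘ₗ g' = g ∘ₗ β) {T : ModuleCat.{u} R} {i : ℕ} (e : Ext (ModuleCat.of R A) T i)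
    (N : Submodule R A) (hα : ∀ x, α x ∈ N)
    (he : (Ext.mk₀ (ModuleCat.ofHom N.subtype)).comp e (zero_add i) = 0) :
    (Ext.mk₀ (ModuleCat.ofHom γ)).comp
      ((sc_exact f g hf hg hfg).extClass.comp e (add_comm 1 i)) (zero_add (i + 1)) = 0 :=
  kill_helper hf hg hfg hf' hg' hfg' α β γ h1 h2 e (kill_sub α N hα e he)

lemma ker_abs (g' : B' →ₗ[R] C') (β : B' →ₗ[R] B) (f : B →ₗ[R] C)
    (h : ∀ x, g' x = 0 → f (β x) = 0) :
    ∃ (K : Type u) (_ : AddCommGroup K) (_ : Module R K) (ι : K →ₗ[R] B')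
      (α : K →ₗ[R] LinearMap.ker f), Function.Injective ι ∧ Function.Exact ι g' ∧
      ∀ x, (α x).1 = β (ι x) :=
  ⟨LinearMap.ker g', inferInstance, inferInstance, (LinearMap.ker g').subtype,
    LinearMap.codRestrict _ (β ∘ₗ (LinearMap.ker g').subtype) (fun x => h x.1 x.2),
    Subtype.val_injective, fun x => by simp, fun _ => rfl⟩

lemma ext_kill [IsNoetherianRing R] (T : ModuleCat.{u} R) (k : ℕ)
    (hk : ∀ r ∈ J ^ k, ∀ t : T, r • t = 0) (i : ℕ) :
    ∀ (L : Type u) [AddCommGroup L] [Module R L] [Module.Finite R L]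
      (e : Ext (ModuleCat.of R L) T i),
      ∃ m, (Ext.mk₀ (ModuleCat.ofHom (J ^ m • ⊤ : Submodule R L).subtype)).comp e (zero_add i) = 0 := by
  induction i with
  | zero =>
    intro L _ _ _ e
    obtain ⟨φ, rfl⟩ := ex_mk₀ e
    refine ⟨k, ?_⟩
    rw [Ext.mk₀_comp_mk₀]
    have : ModuleCat.ofHom (J ^ k • ⊤ : Submodule R L).subtype ≫ φ = 0 := by
      refine ModuleCat.hom_ext (LinearMap.ext fun x => ?_)
      change φ.hom x.1 = 0
      refine Submodule.smul_induction_on x.2 (fun r hr n _ => ?_) (fun x y hx hy => ?_)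
      · rw [map_smul, hk r hr]
      · rw [map_add, hx, hy, add_zero]
    rw [this]; simp
  | succ i ih =>
    intro L _ _ _ e
    obtain ⟨n, f, hf⟩ := Module.Finite.exists_fin' R L
    have hS : Function.Exact (LinearMap.ker f).subtype f := by
      intro x; simp
    have hinj : Function.Injective (LinearMap.ker f).subtype := Subtype.val_injective
    have : Projective (ModuleCat.of R (Fin n → R)) := by
      rw [← IsProjective.iff_projective]; infer_instance
    have : Projective (sc (LinearMap.ker f).subtype f hS).X₂ := this
    obtain ⟨(e' : Ext (ModuleCat.of R (LinearMap.ker f)) T i), he'⟩ :=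
      Ext.contravariant_sequence_exact₃ (sc_exact _ f hinj hf hS) T e
      (Ext.eq_zero_of_projective _) (add_comm 1 i)
    obtain ⟨b, hb⟩ := ih (LinearMap.ker f) e'
    obtain ⟨c, hc⟩ := Ideal.exists_pow_inf_eq_pow_smul J (LinearMap.ker f)
    refine ⟨b + c, ?_⟩
    have hle : ∀ x ∈ (J ^ (b + c) • ⊤ : Submodule R (Fin n → R)), f x ∈ (J ^ (b + c) • ⊤ : Submodule R L) := by
      intro x hx
      have : f x ∈ Submodule.map f (J ^ (b + c) • ⊤) := ⟨x, hx, rfl⟩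
      rw [Submodule.map_smul''] at this
      exact Submodule.smul_mono le_rfl le_top this
    obtain ⟨g', hg'def⟩ : ∃ g' : (J ^ (b + c) • ⊤ : Submodule R (Fin n → R)) →ₗ[R]
        (J ^ (b + c) • ⊤ : Submodule R L), ∀ x, (g' x).1 = f x.1 :=
      ⟨f.restrict hle, fun _ => rfl⟩
    have hg' : Function.Surjective g' := by
      rintro ⟨y, hy⟩
      have hy' : y ∈ Submodule.map f (J ^ (b + c) • ⊤) := by
        rw [Submodule.map_smul'', Submodule.map_top, LinearMap.range_eq_top.2 hf]; exact hy
      obtain ⟨x, hx, rfl⟩ := hy'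
      exact ⟨⟨x, hx⟩, Subtype.ext (hg'def _)⟩
    obtain ⟨K, _, _, ι, α0, hinj', hS', hα0⟩ := ker_abs g' (Submodule.subtype _) f
      (fun x hx => by
        have := hg'def x
        rw [hx] at this
        exact this.symm)
    have hα : ∀ x, α0 x ∈ (J ^ b • ⊤ : Submodule R (LinearMap.ker f)) := by
      intro x
      have h1 : (ι x).1 ∈ (J ^ (b + c) • ⊤ ⊓ LinearMap.ker f : Submodule R (Fin n → R)) :=
        ⟨(ι x).2, by rw [← Submodule.subtype_apply, ← hα0]; exact (α0 x).2⟩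
      rw [hc _ (by omega), Nat.add_sub_cancel] at h1
      have h2 : (ι x).1 ∈ Submodule.map (LinearMap.ker f).subtype (J ^ b • ⊤) := by
        rw [Submodule.map_smul'', Submodule.map_top, Submodule.range_subtype]
        exact Submodule.smul_mono le_rfl inf_le_right h1
      obtain ⟨y, hy, hyx⟩ := h2
      have : α0 x = y := Subtype.ext ((hα0 x).trans hyx.symm)
      rw [this]; exact hy
    rw [← he']
    have hcm : (Submodule.subtype _) ∘ₗ ι =
      (LinearMap.ker f).subtype ∘ₗ α0 := LinearMap.ext fun x => (hα0 x).symm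
    exact kill_both hinj hf hS hinj' hg' hS' α0
      (Submodule.subtype _) (Submodule.subtype _) hcm
      (LinearMap.ext fun x => hg'def x) e' (J ^ b • ⊤ : Submodule R (LinearMap.ker f)) hα hb

lemma H_torsion [IsNoetherianRing R] {T : Type u} [AddCommGroup T] [Module R T] (k : ℕ)
    (hk : ∀ r ∈ J ^ k, ∀ t : T, r • t = 0) (i : ℕ) (z : H J (i + 1) T) : z = 0 := by
  obtain ⟨n, e, rfl⟩ := inc_surj J _ _ z
  have hex : ∀ n, Function.Exact (J ^ n).subtype (J ^ n).mkQ := fun n => by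
    intro x
    rw [Submodule.mkQ_apply, Submodule.Quotient.mk_eq_zero]; simp
  have hi : ∀ n, Function.Injective (J ^ n).subtype := fun n => Subtype.val_injective
  have : Projective (ModuleCat.of R R) := by
      rw [← IsProjective.iff_projective]; infer_instance
  have : Projective (sc (J ^ n).subtype (J ^ n).mkQ (hex n)).X₂ := this
  obtain ⟨e', he'⟩ := Ext.contravariant_sequence_exact₃ (sc_exact _ _ (hi n) (J ^ n).mkQ_surjective (hex n)) _ e
      (Ext.eq_zero_of_projective _) (add_comm 1 i)
  obtain ⟨m, hm⟩ := ext_kill J (ModuleCat.of R T) k hk i (J ^ n : Ideal R) e'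
  have hle : J ^ (m + n) ≤ J ^ n := Ideal.pow_le_pow_right (by omega)
  rw [← inc_tr J _ _ (Nat.le_add_left n m), ← he']
  have hα : ∀ x : (J ^ (m + n) : Ideal R), Submodule.inclusion hle x ∈ (J ^ m • ⊤ : Submodule R (J ^ n : Ideal R)) := by
    intro x
    have h2 : x.1 ∈ Submodule.map (J ^ n : Ideal R).subtype (J ^ m • ⊤) := by
      rw [Submodule.map_smul'', Submodule.map_top, Submodule.range_subtype]
      exact (pow_add J m n).le x.2
    obtain ⟨y, hy, hyx⟩ := h2
    have : Submodule.inclusion hle x = y := Subtype.ext hyx.symm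
    rw [this]; exact hy
  have h3 := kill_helper (hi n) (J ^ n).mkQ_surjective (hex n) (hi (m + n)) (J ^ (m + n)).mkQ_surjective
    (hex (m + n)) (Submodule.inclusion hle) LinearMap.id
    (Submodule.mapQ _ _ LinearMap.id (Ideal.pow_le_pow_right (Nat.le_add_left n m))) rfl rfl e'
    (kill_sub _ _ hα e' hm)
  refine Eq.trans ?_ (map_zero (inc J (i + 1) (ModuleCat.of R T) (m + n)))
  exact congrArg _ h3

end torsion
end LC

namespace LC

section tex

variable {R : Type u} [CommRing R] (J : Ideal R)
variable {A B C D A' B' C' : Type u} [AddCommGroup A] [Module R A] [AddCommGroup B] [Module R B]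
  [AddCommGroup C] [Module R C] [AddCommGroup A'] [Module R A'] [AddCommGroup B'] [Module R B']
  [AddCommGroup C'] [Module R C'] [AddCommGroup D] [Module R D]

lemma IsTor.zero : IsTor J (0 : A) := ⟨0, by simp⟩

variable {J}

lemma IsTor.add {a b : A} (ha : IsTor J a) (hb : IsTor J b) : IsTor J (a + b) := by
  obtain ⟨k, hk⟩ := ha
  obtain ⟨l, hl⟩ := hb
  refine ⟨k + l, fun r hr => ?_⟩
  rw [smul_add, hk r (Ideal.pow_le_pow_right (Nat.le_add_right _ _) hr),
    hl r (Ideal.pow_le_pow_right (Nat.le_add_left _ _) hr), add_zero]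

lemma IsTor.smul {a : A} (ha : IsTor J a) (r : R) : IsTor J (r • a) := by
  obtain ⟨k, hk⟩ := ha
  refine ⟨k, fun s hs => ?_⟩
  rw [smul_comm, hk s hs, smul_zero]

lemma IsTor.map {a : A} (ha : IsTor J a) (f : A →ₗ[R] B) : IsTor J (f a) := by
  obtain ⟨k, hk⟩ := ha
  exact ⟨k, fun s hs => by rw [← map_smul, hk s hs, map_zero]⟩

lemma IsTor.sub {a b : A} (ha : IsTor J a) (hb : IsTor J b) : IsTor J (a - b) := by
  have := ha.add (hb.smul (-1))
  simpa [sub_eq_add_neg] using this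

variable (J) in
/-- Torsion submodule. -/
def torS (A : Type u) [AddCommGroup A] [Module R A] : Submodule R A where
  carrier := {a | IsTor J a}
  add_mem' := IsTor.add
  zero_mem' := IsTor.zero J
  smul_mem' r _ ha := ha.smul r

lemma fg_tor_kill (N : Submodule R A) (hN : N.FG) (h : ∀ a ∈ N, IsTor J a) :
    ∃ k, ∀ r ∈ J ^ k, ∀ a ∈ N, r • a = 0 := by
  induction N, hN using Submodule.fg_induction with
  | singleton x =>
    obtain ⟨k, hk⟩ := h x (Submodule.mem_span_singleton_self x)
    refine ⟨k, fun r hr a ha => ?_⟩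
    obtain ⟨s, rfl⟩ := Submodule.mem_span_singleton.1 ha
    rw [smul_comm, hk r hr, smul_zero]
  | sup N₁ N₂ _ _ h1 h2 =>
    obtain ⟨k, hk⟩ := h1 fun a ha => h a (Submodule.mem_sup_left ha)
    obtain ⟨l, hl⟩ := h2 fun a ha => h a (Submodule.mem_sup_right ha)
    refine ⟨k + l, fun r hr a ha => ?_⟩
    obtain ⟨x, hx, y, hy, rfl⟩ := Submodule.mem_sup.1 ha
    rw [smul_add, hk r (Ideal.pow_le_pow_right (Nat.le_add_right _ _) hr) _ hx,
      hl r (Ideal.pow_le_pow_right (Nat.le_add_left _ _) hr) _ hy, add_zero]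

lemma IsTor.of_smul [IsNoetherianRing R] {a : A} (k : ℕ) (h : ∀ r ∈ J ^ k, IsTor J (r • a)) :
    IsTor J a := by
  obtain ⟨l, hl⟩ := fg_tor_kill (J := J) (Submodule.map (LinearMap.toSpanSingleton R A a) (J ^ k))
    ((IsNoetherian.noetherian (J ^ k)).map _) (by
      rintro _ ⟨r, hr, rfl⟩
      exact h r hr)
  refine ⟨l + k, fun r hr => ?_⟩
  rw [pow_add] at hr
  refine Submodule.mul_induction_on hr (fun s hs t ht => ?_) (fun x y hx hy => ?_)
  · rw [mul_smul]
    exact hl s hs _ ⟨t, ht, rfl⟩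
  · rw [add_smul, hx, hy, add_zero]

variable (J)

/-- Right exact sequence with torsion kernel. -/
structure TEx (f : A →ₗ[R] B) (g : B →ₗ[R] C) : Prop where
  tor : ∀ a, f a = 0 → IsTor J a
  surj : Function.Surjective g
  exact : Function.Exact f g

lemma ker_kill [IsNoetherianRing R] [Module.Finite R A] {f : A →ₗ[R] B}
    (hf : ∀ a, f a = 0 → IsTor J a) : ∃ k, ∀ r ∈ J ^ k, ∀ a : LinearMap.ker f, r • a = 0 := by
  obtain ⟨k, hk⟩ := fg_tor_kill (J := J) (LinearMap.ker f) (IsNoetherian.noetherian _)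
    (fun a ha => hf a ha)
  exact ⟨k, fun r hr a => Subtype.ext (hk r hr _ a.2)⟩

lemma exact_ker (f : A →ₗ[R] B) : Function.Exact (LinearMap.ker f).subtype f := by
  intro x; simp

lemma torMap_surj [IsNoetherianRing R] [Module.Finite R A] {f : A →ₗ[R] D}
    (hf : ∀ a, f a = 0 → IsTor J a) (hs : Function.Surjective f) (i : ℕ) :
    Function.Surjective (Hmap J i f) := by
  intro z
  obtain ⟨k, hk⟩ := ker_kill J hf
  refine H_ex3 J i (LinearMap.ker f).injective_subtype hs (exact_ker f) z ?_
  exact H_torsion J k hk i _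

lemma torMap_inj [IsNoetherianRing R] [Module.Finite R A] {f : A →ₗ[R] D}
    (hf : ∀ a, f a = 0 → IsTor J a) (hs : Function.Surjective f) (i : ℕ) :
    Function.Injective (Hmap J (i + 1) f) := by
  rw [injective_iff_map_eq_zero]
  intro z hz
  obtain ⟨k, hk⟩ := ker_kill J hf
  obtain ⟨w, rfl⟩ := H_ex2 J (i + 1) (LinearMap.ker f).injective_subtype hs (exact_ker f) z hz
  rw [H_torsion J k hk i w, map_zero]

lemma exact_range {f : A →ₗ[R] B} {g : B →ₗ[R] C} (h : Function.Exact f g) :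
    Function.Exact (LinearMap.range f).subtype g := by
  intro x
  rw [h x]; simp

lemma TEx.rr {f : A →ₗ[R] B} {g : B →ₗ[R] C} (h : TEx J f g) (a : A)
    (ha : f.rangeRestrict a = 0) : IsTor J a := h.tor a (congrArg Subtype.val ha)

variable [IsNoetherianRing R] [Module.Finite R A] [Module.Finite R A']

/-- The connecting map. -/
noncomputable def genδ (i : ℕ) {f : A →ₗ[R] B} {g : B →ₗ[R] C} (h : TEx J f g) :
    H J i C →ₗ[R] H J (i + 1) A :=
  (LinearEquiv.ofBijective (Hmap J (i + 1) f.rangeRestrict)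
    ⟨torMap_inj J h.rr f.surjective_rangeRestrict i,
      torMap_surj J h.rr f.surjective_rangeRestrict (i + 1)⟩).symm.toLinearMap ∘ₗ
  Hδ J i (LinearMap.range f).subtype g (LinearMap.range f).injective_subtype h.surj
    (exact_range h.exact)

variable {f : A →ₗ[R] B} {g : B →ₗ[R] C} (h : TEx J f g)
variable {f' : A' →ₗ[R] B'} {g' : B' →ₗ[R] C'} (h' : TEx J f' g')

lemma genδ_spec (i : ℕ) (w : H J i C) :
    Hmap J (i + 1) f.rangeRestrict (genδ J i h w) =
    Hδ J i (LinearMap.range f).subtype g (LinearMap.range f).injective_subtype h.surj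
    (exact_range h.exact) w := by
  simp only [genδ, LinearMap.comp_apply]
  exact LinearEquiv.apply_symm_apply (LinearEquiv.ofBijective (Hmap J (i + 1) f.rangeRestrict)
    ⟨torMap_inj J h.rr f.surjective_rangeRestrict i,
      torMap_surj J h.rr f.surjective_rangeRestrict (i + 1)⟩) _

lemma rr_factor (f : A →ₗ[R] B) (i : ℕ) (z : H J i A) :
    Hmap J i f z = Hmap J i (LinearMap.range f).subtype (Hmap J i f.rangeRestrict z) := by
  rw [Hmap_comp]; rfl

lemma genδ_ex1 (i : ℕ) (w : H J i C) (hw : genδ J i h w = 0) : ∃ v, Hmap J i g v = w := by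
  have := genδ_spec J h i w
  rw [hw, map_zero] at this
  exact H_ex3 J i _ _ _ w this.symm

lemma genδ_Hmap (i : ℕ) (v : H J i B) : genδ J i h (Hmap J i g v) = 0 := by
  apply torMap_inj J h.rr f.surjective_rangeRestrict i
  rw [genδ_spec, Hδ_Hmap, map_zero]

lemma genδ_ex2 (i : ℕ) (z : H J (i + 1) A) (hz : Hmap J (i + 1) f z = 0) :
    ∃ w, genδ J i h w = z := by
  rw [rr_factor] at hz
  obtain ⟨w, hw⟩ := H_ex1 J i (LinearMap.range f).injective_subtype h.surj
    (exact_range h.exact) _ hz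
  refine ⟨w, ?_⟩
  apply torMap_inj J h.rr f.surjective_rangeRestrict i
  rw [genδ_spec, hw]

lemma Hmap_genδ (i : ℕ) (w : H J i C) : Hmap J (i + 1) f (genδ J i h w) = 0 := by
  rw [rr_factor, genδ_spec, Hmap_Hδ]

include h in
lemma genδ_ex3 (i : ℕ) (z : H J i B) (hz : Hmap J i g z = 0) : ∃ w, Hmap J i f w = z := by
  obtain ⟨w, hw⟩ := H_ex2 J i (LinearMap.range f).injective_subtype h.surj
    (exact_range h.exact) _ hz
  obtain ⟨v, rfl⟩ := torMap_surj J h.rr f.surjective_rangeRestrict i w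
  exact ⟨v, by rw [rr_factor, hw]⟩

lemma genδ_nat (i : ℕ) (α : A →ₗ[R] A') (β : B →ₗ[R] B') (γ : C →ₗ[R] C') (h1 : ∀ a, β (f a) = f' (α a))
    (h2 : ∀ b, γ (g b) = g' (β b)) (w : H J i C) :
    genδ J i h' (Hmap J i γ w) = Hmap J (i + 1) α (genδ J i h w) := by
  apply torMap_inj J h'.rr f'.surjective_rangeRestrict i
  have hr : ∀ x ∈ LinearMap.range f, β x ∈ LinearMap.range f' := by
    rintro _ ⟨a, rfl⟩
    exact ⟨α a, (h1 a).symm⟩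
  rw [genδ_spec, Hmap_comp, Hδ_nat J i (LinearMap.range f).injective_subtype h.surj
    (exact_range h.exact) _ _ _ (β.restrict hr) β γ rfl (LinearMap.ext h2), ← genδ_spec J h,
    Hmap_comp]
  congr 2
  exact LinearMap.ext fun a => Subtype.ext (h1 a)

end tex
end LC

namespace LC

section split

lemma equiv_of_ker {R : Type*} [CommRing R] {X Y Z : Type*} [AddCommGroup X] [Module R X]
    [AddCommGroup Y] [Module R Y] [AddCommGroup Z] [Module R Z] (φ : X →ₗ[R] Y) (ψ : X →ₗ[R] Z)
    (hφ : Function.Surjective φ) (hψ : Function.Surjective ψ)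
    (h : ∀ x, φ x = 0 ↔ ψ x = 0) : Nonempty (Y ≃ₗ[R] Z) := by
  have hk : LinearMap.ker φ = LinearMap.ker ψ := by
    ext x; exact h x
  exact ⟨(φ.quotKerEquivOfSurjective hφ).symm.trans
    ((Submodule.quotEquivOfEq _ _ hk).trans (ψ.quotKerEquivOfSurjective hψ))⟩

lemma split_abs {R : Type*} [CommRing R] {A B C K : Type*} [AddCommGroup A] [Module R A]
    [AddCommGroup B] [Module R B] [AddCommGroup C] [Module R C] [AddCommGroup K] [Module R K]
    (ι : A →ₗ[R] B) (δ : B →ₗ[R] C) (hι : ∀ a, ι a = 0 → a = 0) (h0 : ∀ a, δ (ι a) = 0)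
    (hex : ∀ b, δ b = 0 → ∃ a, ι a = b) (U : Submodule R C)
    (e : K →ₗ[R] C) (s : K →ₗ[R] B) (hs : ∀ k, δ (s k) = e k)
    (hU : ∀ u ∈ U, ∃ k, e k = u) (hk : ∀ k, e k = 0 → s k = 0) :
    Nonempty (U.comap δ ≃ₗ[R] A × U) := by
  let φ : A × (U.comap e) →ₗ[R] U.comap δ :=
    LinearMap.codRestrict _ (ι.coprod (s ∘ₗ (U.comap e).subtype)) (fun x => by
      simp only [LinearMap.coprod_apply, Submodule.mem_comap, map_add, h0, zero_add,
        LinearMap.comp_apply, hs]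
      exact x.2.2)
  let ψ : A × (U.comap e) →ₗ[R] A × U :=
    LinearMap.prodMap LinearMap.id (e.restrict (fun x hx => hx))
  refine equiv_of_ker φ ψ ?_ ?_ ?_
  · rintro ⟨b, hb⟩
    obtain ⟨k, hk⟩ := hU _ hb
    obtain ⟨a, ha⟩ := hex (b - s k) (by rw [map_sub, hs, hk, sub_self])
    refine ⟨(a, ⟨k, by rw [Submodule.mem_comap, hk]; exact hb⟩), Subtype.ext ?_⟩
    change ι a + s k = b
    rw [ha]; abel
  · rintro ⟨a, ⟨u, hu⟩⟩
    obtain ⟨k, rfl⟩ := hU _ hu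
    exact ⟨(a, ⟨k, hu⟩), rfl⟩
  · rintro ⟨a, ⟨k, hk'⟩⟩
    constructor
    · intro hx
      have hx : ι a + s k = 0 := congrArg Subtype.val hx
      have h1 : e k = 0 := by
        have := congrArg δ hx
        rwa [map_add, h0, hs, zero_add, map_zero] at this
      rw [hk k h1, add_zero] at hx
      exact Prod.ext (hι a hx) (Subtype.ext h1)
    · intro hx
      have h1 : a = 0 := congrArg Prod.fst hx
      have h2 : e k = 0 := congrArg Subtype.val (congrArg Prod.snd hx)
      apply Subtype.ext
      change ι a + s k = 0
      rw [h1, hk k h2, map_zero, zero_add]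

variable {R : Type u} [CommRing R] (J : Ideal R)

/-- The submodule `aM`. -/
abbrev aM (a : R) (M : Type u) [AddCommGroup M] [Module R M] : Submodule R M :=
  LinearMap.range (a • (LinearMap.id : M →ₗ[R] M))

lemma mem_aM {a : R} {M : Type u} [AddCommGroup M] [Module R M] {x : M} :
    x ∈ aM a M ↔ ∃ m, a • m = x := Iff.rfl

/-- The module `M/aM`. -/
abbrev q (a : R) (M : Type u) [AddCommGroup M] [Module R M] : Type u := M ⧸ aM a M

/-- `a` is filter regular on `M`. -/
def FR1 (a : R) (M : Type u) [AddCommGroup M] [Module R M] : Prop :=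
  ∀ m : M, a • m = 0 → IsTor J m

lemma exact_mkQ {A B : Type u} [AddCommGroup A] [Module R A] [AddCommGroup B] [Module R B]
    (f : A →ₗ[R] B) : Function.Exact f (LinearMap.range f).mkQ := by
  intro x
  rw [Submodule.mkQ_apply, Submodule.Quotient.mk_eq_zero]; rfl

variable {J} in
lemma texA {a : R} {M : Type u} [AddCommGroup M] [Module R M] (h : FR1 J a M) :
    TEx J (a • (LinearMap.id : M →ₗ[R] M)) (aM a M).mkQ :=
  ⟨fun m hm => h m hm, Submodule.mkQ_surjective _, exact_mkQ _⟩

/-- `J^n` kills the local cohomology. -/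
def Kills (n i : ℕ) (M : Type u) [AddCommGroup M] [Module R M] : Prop :=
  ∀ r ∈ J ^ n, ∀ z : H J i M, r • z = 0

lemma Hmap_smul_id (i : ℕ) (a : R) {M : Type u} [AddCommGroup M] [Module R M] (z : H J i M) :
    Hmap J i (a • (LinearMap.id : M →ₗ[R] M)) z = a • z := by
  rw [Hmap_smul, Hmap_id]

lemma factor_abs {M : Type u} [AddCommGroup M] [Module R M] [Module.Finite R M] (n : ℕ) {a : R}
    (ha : a ∈ J ^ n * J ^ n) :
    ∃ (P : Type u) (_ : AddCommGroup P) (_ : Module R P) (f : M →ₗ[R] P) (g : P →ₗ[R] M),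
      (∀ m, g (f m) = a • m) ∧ (∀ i, Kills J n i M → ∀ w, Hmap J i g w = 0) ∧
      (∀ i z, (∀ r ∈ J ^ n, r • z = 0) → Hmap J i f z = 0) := by
  refine Submodule.mul_induction_on ha (fun b hb c hc => ?_) (fun x y hx hy => ?_)
  · refine ⟨M, inferInstance, inferInstance, c • LinearMap.id, b • LinearMap.id, fun m => ?_,
      fun i hi w => ?_, fun i z hz => ?_⟩
    · simp [mul_smul, smul_comm b c]
    · rw [Hmap_smul_id, hi b hb]
    · rw [Hmap_smul_id, hz c hc]
  · obtain ⟨P, _, _, f, g, h1, h2, h3⟩ := hx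
    obtain ⟨P', _, _, f', g', h1', h2', h3'⟩ := hy
    refine ⟨P × P', inferInstance, inferInstance,
      LinearMap.inl R P P' ∘ₗ f + LinearMap.inr R P P' ∘ₗ f',
      g ∘ₗ LinearMap.fst R P P' + g' ∘ₗ LinearMap.snd R P P', fun m => ?_,
      fun i hi w => ?_, fun i z hz => ?_⟩
    · simp [h1, h1', add_smul]
    · rw [Hmap_add, ← Hmap_comp, ← Hmap_comp, h2 i hi, h2' i hi, add_zero]
    · rw [Hmap_add, ← Hmap_comp, ← Hmap_comp, h3 i z hz, h3' i z hz, map_zero, map_zero, add_zero]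

variable [IsNoetherianRing R]

lemma splitting {M : Type u} [AddCommGroup M] [Module R M] [Module.Finite R M] (n : ℕ) {a : R}
    (ha : a ∈ J ^ n * J ^ n) (hr : FR1 J a M) (i : ℕ) (hi : Kills J n i M)
    (U : Submodule R (H J (i + 1) M)) (hU : ∀ u ∈ U, ∀ r ∈ J ^ n, r • u = 0) :
    Nonempty (U.comap (genδ J i (texA hr)) ≃ₗ[R] H J i M × U) := by
  obtain ⟨P, _, _, f, g, h1, h2, h3⟩ := factor_abs J (M := M) n ha
  have hf : TEx J f (LinearMap.range f).mkQ :=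
    ⟨fun m hm => hr m (by rw [← h1, hm, map_zero]), Submodule.mkQ_surjective _, exact_mkQ _⟩
  have hle : LinearMap.range f ≤ (aM a M).comap g := by
    rintro _ ⟨m, rfl⟩
    exact ⟨m, (h1 m).symm⟩
  have haJ : a ∈ J ^ n := Ideal.mul_le_left ha
  refine split_abs (Hmap J i (aM a M).mkQ) (genδ J i (texA hr)) ?_ (genδ_Hmap J (texA hr) i)
    (genδ_ex1 J (texA hr) i) U (genδ J i hf)
    (Hmap J i (Submodule.mapQ _ _ g hle)) ?_ ?_ ?_
  · intro z hz
    obtain ⟨w, hw⟩ := genδ_ex3 J (texA hr) i z hz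
    rw [← hw, Hmap_smul_id, hi a haJ]
  · intro k
    rw [genδ_nat J hf (texA hr) i LinearMap.id g _ (fun m => h1 m) (fun b => rfl), Hmap_id]
  · intro u hu
    exact genδ_ex2 J hf i u (h3 _ u (hU u hu))
  · intro k hk
    obtain ⟨v, rfl⟩ := genδ_ex1 J hf i k hk
    rw [Hmap_comp, Submodule.mapQ_mkQ, ← Hmap_comp, h2 i hi, map_zero]

lemma Kills_q {M : Type u} [AddCommGroup M] [Module R M] [Module.Finite R M] (n : ℕ) {a : R}
    (ha : a ∈ J ^ n * J ^ n) (hr : FR1 J a M) (i : ℕ) (hi : Kills J n i M)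
    (hi' : Kills J n (i + 1) M) : Kills J n i (q a M) := by
  intro r hrn z
  obtain ⟨e⟩ := splitting J n ha hr i hi ⊤ (fun u _ r hr => hi' r hr u)
  have h1 : r • (⟨z, trivial⟩ : Submodule.comap (genδ J i (texA hr)) ⊤) = 0 := by
    apply e.injective
    rw [map_smul, map_zero]
    refine Prod.ext (hi r hrn _) (Subtype.ext (hi' r hrn _))
  exact congrArg Subtype.val h1

end split
end LC

namespace LC

section tower

variable {R : Type u} [CommRing R] (J : Ideal R)

/-- Iterated quotient. -/
noncomputable def Q : List R → (M : Type u) → [AddCommGroup M] → [Module R M] → ModuleCat.{u} R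
  | [], M, _, _ => ModuleCat.of R M
  | a :: l, M, _, _ => Q l (q a M)

/-- Filter regular sequences, recursively. -/
def FR : List R → (M : Type u) → [AddCommGroup M] → [Module R M] → Prop
  | [], _, _, _ => True
  | a :: l, M, _, _ => FR1 J a M ∧ FR l (q a M)

/-- Functoriality of the quotient. -/
noncomputable def qmap (a : R) {M N : Type u} [AddCommGroup M] [Module R M] [AddCommGroup N]
    [Module R N] (f : M →ₗ[R] N) : q a M →ₗ[R] q a N :=
  Submodule.mapQ _ _ f (by
    rintro _ ⟨m, rfl⟩
    exact ⟨f m, by simp⟩)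

/-- Functoriality of the iterated quotient. -/
noncomputable def Qmap : (l : List R) → {M N : Type u} → [AddCommGroup M] → [Module R M] →
    [AddCommGroup N] → [Module R N] → (f : M →ₗ[R] N) → (Q l M →ₗ[R] Q l N)
  | [], _, _, _, _, _, _, f => f
  | a :: l, _, _, _, _, _, _, f => Qmap l (qmap a f)

/-- The projection. -/
noncomputable def pr : (l : List R) → (M : Type u) → [AddCommGroup M] → [Module R M] →
    (M →ₗ[R] Q l M)
  | [], _, _, _ => LinearMap.id
  | a :: l, M, _, _ => pr l (q a M) ∘ₗ (aM a M).mkQ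

lemma pr_surj (l : List R) : ∀ (M : Type u) [AddCommGroup M] [Module R M],
    Function.Surjective (pr l M) := by
  induction l with
  | nil => intro M _ _ x; exact ⟨x, rfl⟩
  | cons a l ih => 
    intro M _ _
    exact (ih (q a M)).comp (Submodule.mkQ_surjective _)

lemma pr_ker (l : List R) : ∀ (M : Type u) [AddCommGroup M] [Module R M] (m : M),
    pr l M m = 0 ↔ m ∈ (Ideal.ofList l • ⊤ : Submodule R M) := by
  induction l with
  | nil => 
    intro M _ _ x
    rw [Ideal.ofList_nil, Submodule.bot_smul, Submodule.mem_bot]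
    rfl
  | cons a l ih => 
    intro M _ _ x
    refine (ih (q a M) ((aM a M).mkQ x)).trans ?_
    have h1 : (Ideal.ofList l • ⊤ : Submodule R (q a M)) =
        Submodule.map (aM a M).mkQ (Ideal.ofList l • ⊤) := by
      rw [Submodule.map_smul'', Submodule.map_top, Submodule.range_mkQ]
    rw [h1, ← Submodule.mem_comap, Submodule.comap_map_mkQ, Ideal.ofList_cons, Submodule.sup_smul]
    have h2 : aM a M = Ideal.span {a} • ⊤ := by
      ext y
      rw [mem_aM, Submodule.ideal_span_singleton_smul, Submodule.mem_smul_pointwise_iff_exists]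
      simp
    rw [h2]

lemma Qmap_pr (l : List R) : ∀ {M N : Type u} [AddCommGroup M] [Module R M] [AddCommGroup N]
    [Module R N] (f : M →ₗ[R] N) (m : M), Qmap l f (pr l M m) = pr l N (f m) := by
  induction l with
  | nil => intros; rfl
  | cons a l ih => 
    intro M N _ _ _ _ f m
    exact ih (qmap a f) ((aM a M).mkQ m)

instance Q_finite (l : List R) : ∀ (M : Type u) [AddCommGroup M] [Module R M]
    [Module.Finite R M], Module.Finite R (Q l M) := by
  intro M _ _ _
  exact Module.Finite.of_surjective _ (pr_surj l M)

/-- Multiplication by `a^n`. -/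
noncomputable def mulq (a : R) (n : ℕ) (M : Type u) [AddCommGroup M] [Module R M] :
    q a M →ₗ[R] q (a ^ (n + 1)) M :=
  Submodule.mapQ _ _ (a ^ n • LinearMap.id) (by
    rintro _ ⟨m, rfl⟩
    exact ⟨m, by simp [pow_succ, mul_smul, smul_comm a (a ^ n)]⟩)

/-- The maps in the direct system. -/
noncomputable def mu (n : ℕ) : (l : List R) → (M : Type u) → [AddCommGroup M] → [Module R M] →
    (Q l M →ₗ[R] Q (l.map (· ^ (n + 1))) M)
  | [], _, _, _ => LinearMap.id
  | a :: l, M, _, _ => mu n l (q (a ^ (n + 1)) M) ∘ₗ Qmap l (mulq a n M)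

lemma mu_pr (n : ℕ) (l : List R) : ∀ (M : Type u) [AddCommGroup M] [Module R M] (m : M),
    mu n l M (pr l M m) = pr (l.map (· ^ (n + 1))) M (l.prod ^ n • m) := by
  induction l with
  | nil => 
    intro M _ _ m
    rw [List.prod_nil, one_pow, one_smul]; rfl
  | cons a l ih => 
    intro M _ _ m
    change mu n l _ (Qmap l (mulq a n M) (pr l _ ((aM a M).mkQ m))) = _
    rw [Qmap_pr, ih, List.prod_cons, mul_pow, mul_comm, mul_smul]
    rfl

lemma FR_sub (l : List R) : ∀ (M : Type u) [AddCommGroup M] [Module R M] [Subsingleton M],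
    FR J l M := by
  induction l with
  | nil => intros; trivial
  | cons a l ih => 
    intro M _ _ _
    refine ⟨fun m _ => ?_, ih _⟩
    rw [Subsingleton.elim m 0]; exact IsTor.zero J

variable [IsNoetherianRing R]

lemma FR_ext (l : List R) : ∀ {A C B : Type u} [AddCommGroup A] [Module R A] [AddCommGroup B]
    [Module R B] [AddCommGroup C] [Module R C] (f : A →ₗ[R] C) (g : C →ₗ[R] B) (_ : TEx J f g),
    FR J l A → FR J l B → FR J l C ∧ ∀ y, Qmap l f y = 0 → IsTor J y := by
  induction l with
  | nil => 
    intro A C B _ _ _ _ _ _ f g h _ _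
    exact ⟨trivial, h.tor⟩
  | cons a l ih =>
    intro A C B _ _ _ _ _ _ f g h hA hB
    have h1 : ∀ c : C, g (a • c) = 0 → ∃ k, ∀ r ∈ J ^ k, ∃ x, f x = r • c := by
      intro c hc
      rw [map_smul] at hc
      obtain ⟨k, hk⟩ := hB.1 _ hc
      refine ⟨k, fun r hr => ?_⟩
      have := hk r hr
      rw [← map_smul] at this
      exact (h.exact _).1 this
    have h2 : FR1 J a C := by
      intro c hc
      obtain ⟨k, hk⟩ := h1 c (by rw [hc, map_zero])
      refine IsTor.of_smul k fun r hr => ?_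
      obtain ⟨x, hx⟩ := hk r hr
      rw [← hx]
      apply IsTor.map
      obtain ⟨k', hk'⟩ := h.tor (a • x) (by rw [map_smul, hx, smul_comm, hc, smul_zero])
      refine IsTor.of_smul k' fun r' hr' => hA.1 _ ?_
      rw [smul_comm, hk' r' hr']
    have h3 : TEx J (qmap a f) (qmap a g) := by
      refine ⟨fun x hx => ?_, fun y => ?_, fun y => ⟨fun hy => ?_, ?_⟩⟩
      · obtain ⟨x, rfl⟩ := Submodule.mkQ_surjective _ x
        have hx' : (aM a C).mkQ (f x) = 0 := hx
        rw [Submodule.mkQ_apply, Submodule.Quotient.mk_eq_zero] at hx'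
        obtain ⟨c, hc⟩ := hx'
        have hc : a • c = f x := hc
        obtain ⟨k, hk⟩ := h1 c (by rw [hc, h.exact.apply_apply_eq_zero])
        refine IsTor.of_smul k fun r hr => ?_
        obtain ⟨y, hy⟩ := hk r hr
        have h4 : IsTor J (r • x - a • y) := h.tor _ (by
          rw [map_sub, map_smul, map_smul, hy, ← hc, smul_comm, sub_self])
        have h5 := h4.map (aM a A).mkQ
        have h6 : (aM a A).mkQ (a • y) = 0 := by
          rw [Submodule.mkQ_apply, Submodule.Quotient.mk_eq_zero]
          exact ⟨y, rfl⟩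
        rwa [map_sub, h6, sub_zero, map_smul] at h5
      · obtain ⟨y, rfl⟩ := Submodule.mkQ_surjective _ y
        obtain ⟨c, rfl⟩ := h.surj y
        exact ⟨(aM a C).mkQ c, rfl⟩
      · obtain ⟨c, rfl⟩ := Submodule.mkQ_surjective _ y
        have hx' : (aM a B).mkQ (g c) = 0 := hy
        rw [Submodule.mkQ_apply, Submodule.Quotient.mk_eq_zero] at hx'
        obtain ⟨b, hb⟩ := hx'
        obtain ⟨c', rfl⟩ := h.surj b
        have hb : a • g c' = g c := hb
        obtain ⟨x, hx⟩ := (h.exact (c - a • c')).1 (by rw [map_sub, map_smul, hb, sub_self])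
        refine ⟨(aM a A).mkQ x, ?_⟩
        change (aM a C).mkQ (f x) = _
        have h6 : (aM a C).mkQ (a • c') = 0 := by
          rw [Submodule.mkQ_apply, Submodule.Quotient.mk_eq_zero]
          exact ⟨c', rfl⟩
        rw [hx, map_sub, h6, sub_zero]
      · rintro ⟨x, rfl⟩
        obtain ⟨x, rfl⟩ := Submodule.mkQ_surjective _ x
        change (aM a B).mkQ (g (f x)) = 0
        rw [h.exact.apply_apply_eq_zero, map_zero]
    obtain ⟨h4, h5⟩ := ih (qmap a f) (qmap a g) h3 hA.2 hB.2
    exact ⟨⟨h2, h4⟩, h5⟩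

lemma FR1_pow {a : R} {M : Type u} [AddCommGroup M] [Module R M] (h : FR1 J a M) (n : ℕ) :
    FR1 J (a ^ n) M := by
  induction n with
  | zero => 
    intro m hm
    rw [pow_zero, one_smul] at hm
    rw [hm]; exact IsTor.zero J
  | succ n ih =>
    intro m hm
    rw [pow_succ, mul_smul] at hm
    obtain ⟨k, hk⟩ := ih _ hm
    refine IsTor.of_smul k fun r hr => h _ ?_
    rw [smul_comm, hk r hr]

lemma tex_pow {a : R} {M : Type u} [AddCommGroup M] [Module R M] (h : FR1 J a M) (n : ℕ) :
    TEx J (mulq a n M) (Submodule.mapQ (aM (a ^ (n + 1)) M) (aM (a ^ n) M) LinearMap.id (by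
      rintro _ ⟨m, rfl⟩
      exact ⟨a • m, by simp [pow_succ, mul_smul, smul_comm a (a ^ n)]⟩)) := by
  refine ⟨fun x hx => ?_, fun y => ?_, fun y => ⟨fun hy => ?_, ?_⟩⟩
  · obtain ⟨x, rfl⟩ := Submodule.mkQ_surjective _ x
    have hx' : (aM (a ^ (n + 1)) M).mkQ (a ^ n • x) = 0 := hx
    rw [Submodule.mkQ_apply, Submodule.Quotient.mk_eq_zero] at hx'
    obtain ⟨c, hc⟩ := hx'
    have hc : a ^ (n + 1) • c = a ^ n • x := hc
    have h4 : IsTor J (x - a • c) := FR1_pow J h n _ (by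
      rw [smul_sub, ← mul_smul, ← pow_succ, hc, sub_self])
    have h5 := h4.map (aM a M).mkQ
    have h6 : (aM a M).mkQ (a • c) = 0 := by
      rw [Submodule.mkQ_apply, Submodule.Quotient.mk_eq_zero]
      exact ⟨c, rfl⟩
    rwa [map_sub, h6, sub_zero] at h5
  · obtain ⟨y, rfl⟩ := Submodule.mkQ_surjective _ y
    exact ⟨(aM (a ^ (n + 1)) M).mkQ y, rfl⟩
  · obtain ⟨c, rfl⟩ := Submodule.mkQ_surjective _ y
    have hx' : (aM (a ^ n) M).mkQ c = 0 := hy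
    rw [Submodule.mkQ_apply, Submodule.Quotient.mk_eq_zero] at hx'
    obtain ⟨b, rfl⟩ := hx'
    exact ⟨(aM a M).mkQ b, rfl⟩
  · rintro ⟨x, rfl⟩
    obtain ⟨x, rfl⟩ := Submodule.mkQ_surjective _ x
    change (aM (a ^ n) M).mkQ (a ^ n • x) = 0
    rw [Submodule.mkQ_apply, Submodule.Quotient.mk_eq_zero]
    exact ⟨x, rfl⟩

lemma FR_pow {a : R} {M : Type u} [AddCommGroup M] [Module R M] (l : List R) (h : FR J (a :: l) M)
    (n : ℕ) : FR J l (q (a ^ n) M) := by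
  induction n with
  | zero => 
    have : Subsingleton (q (a ^ 0) M) := by
      rw [Submodule.Quotient.subsingleton_iff, eq_top_iff]
      intro x _
      exact ⟨x, by simp⟩
    exact FR_sub J l _
  | succ n ih => exact (FR_ext J l _ _ (tex_pow J h.1 n) h.2 ih).1

lemma mu_tor (n : ℕ) (l : List R) : ∀ (M : Type u) [AddCommGroup M] [Module R M] (_ : FR J l M)
    (y : Q l M), mu n l M y = 0 → IsTor J y := by
  induction l with
  | nil => 
    intro M _ _ _ y hy
    have hy : y = 0 := hy
    rw [hy]; exact IsTor.zero J
  | cons a l ih =>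
    intro M _ _ h y hy
    have h1 := ih (q (a ^ (n + 1)) M) (FR_pow J l h (n + 1)) (Qmap l (mulq a n M) y) hy
    obtain ⟨k, hk⟩ := h1
    refine IsTor.of_smul k fun r hr =>
      (FR_ext J l _ _ (tex_pow J h.1 n) h.2 (FR_pow J l h n)).2 _ ?_
    exact (map_smul (Qmap l (mulq a n M)) r y).trans (hk r hr)

end tower
end LC

namespace LC

section theta

variable {R : Type u} [CommRing R] (J : Ideal R) [IsNoetherianRing R]

/-- The iterated connecting map. -/
noncomputable def θ : (l : List R) → (M : Type u) → [AddCommGroup M] → [Module R M] →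
    [Module.Finite R M] → FR J l M → (H J 0 (Q l M) →ₗ[R] H J l.length M)
  | [], _, _, _, _, _ => LinearMap.id
  | a :: l, M, _, _, _, h => genδ J l.length (texA h.1) ∘ₗ θ l (q a M) h.2

lemma θ_cons (a : R) (l : List R) (M : Type u) [AddCommGroup M] [Module R M]
    [Module.Finite R M] (h : FR J (a :: l) M) (y : H J 0 (Q l (q a M))) :
    θ J (a :: l) M h y = genδ J l.length (texA h.1) (θ J l (q a M) h.2 y) := rfl

lemma θ_nat (l : List R) : ∀ (M N : Type u) [AddCommGroup M] [Module R M]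
    [Module.Finite R M] [AddCommGroup N] [Module R N] [Module.Finite R N]
    (h : FR J l M) (h' : FR J l N) (f : M →ₗ[R] N) (y : H J 0 (Q l M)),
    θ J l N h' (Hmap J 0 (Qmap l f) y) = Hmap J l.length f (θ J l M h y) := by
  induction l with
  | nil => intros; rfl
  | cons a l ih =>
    intro M N _ _ _ _ _ _ h h' f y
    refine (θ_cons J a l N h' (Hmap J 0 (Qmap l (qmap a f)) y)).trans ?_
    refine (congrArg _ (ih (q a M) (q a N) h.2 h'.2 (qmap a f) y)).trans ?_
    refine (genδ_nat J (texA h.1) (texA h'.1) l.length f f (qmap a f) ?_ ?_ _)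
    · intro m; simp
    · intro m; rfl

lemma mu_θ (n : ℕ) (l : List R) : ∀ (M : Type u) [AddCommGroup M] [Module R M]
    [Module.Finite R M] (h : FR J l M) (y : H J 0 (Q l M)),
    Hmap J 0 (mu n l M) y = 0 → θ J l M h y = 0 := by
  induction l with
  | nil => 
    intro M _ _ _ h y hy
    exact (Hmap_id J 0 y).symm.trans hy
  | cons a l ih =>
    intro M _ _ _ h y hy
    have h0 : Hmap J 0 (mu n l (q (a ^ (n + 1)) M)) (Hmap J 0 (Qmap l (mulq a n M)) y) = 0 :=
      (Hmap_comp J 0 (Qmap l (mulq a n M)) (mu n l (q (a ^ (n + 1)) M)) y).trans hy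
    have h1 := ih (q (a ^ (n + 1)) M) (FR_pow J l h (n + 1)) _ h0
    replace h1 := (θ_nat J l (q a M) (q (a ^ (n + 1)) M) h.2 (FR_pow J l h (n + 1))
      (mulq a n M) y).symm.trans h1
    refine (θ_cons J a l M h y).trans ?_
    have h2 := genδ_nat J (texA h.1) (texA (FR1_pow J h.1 (n + 1))) l.length LinearMap.id
      (a ^ n • LinearMap.id) (mulq a n M) (fun m => by simp [pow_succ, mul_smul, smul_comm a (a ^ n)]) (fun m => rfl)
      (θ J l (q a M) h.2 y)
    rw [Hmap_id, h1, map_zero] at h2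
    exact h2.symm

lemma θ_mu (n : ℕ) (l : List R) : ∀ (M : Type u) [AddCommGroup M] [Module R M]
    [Module.Finite R M] (h : FR J l M) (_ : ∀ a ∈ l, a ∈ J ^ n * J ^ n)
    (_ : ∀ i < l.length, Kills J n i M) (y : H J 0 (Q l M)),
    θ J l M h y = 0 → Hmap J 0 (mu 1 l M) y = 0 := by
  induction l with
  | nil => 
    intro M _ _ _ h _ _ y hy
    exact (Hmap_id J 0 y).trans hy
  | cons a l ih =>
    intro M _ _ _ h hl hk y hy
    have ha := hl a List.mem_cons_self
    have haJ : a ∈ J ^ n := Ideal.mul_le_left ha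
    have ha2 : a ^ (1 + 1) ∈ J ^ n * J ^ n := by
      rw [pow_succ]; exact Ideal.mul_mem_left _ _ ha
    refine (Hmap_comp J 0 (Qmap l (mulq a 1 M)) (mu 1 l (q (a ^ (1 + 1)) M)) y).symm.trans ?_
    refine ih (q (a ^ (1 + 1)) M) (FR_pow J l h (1 + 1)) (fun b hb => hl b (List.mem_cons_of_mem _ hb))
      (fun i hi => Kills_q J n ha2 (FR1_pow J h.1 _) i (hk i (by simp; omega))
        (hk (i + 1) (by simp; omega))) _ ?_
    refine (θ_nat J l (q a M) (q (a ^ (1 + 1)) M) h.2 (FR_pow J l h (1 + 1))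
      (mulq a 1 M) y).trans ?_
    obtain ⟨v, hv⟩ := genδ_ex1 J (texA h.1) l.length (θ J l (q a M) h.2 y) hy
    rw [← hv, Hmap_comp]
    have h3 : mulq a 1 M ∘ₗ (aM a M).mkQ = a • (aM (a ^ (1 + 1)) M).mkQ := by
      ext m; simp [mulq]
    rw [h3, Hmap_smul, ← map_smul, hk _ (by simp) a haJ, map_zero]

/-- The iterated doubling. -/
def TT : ℕ → (ℕ → ModuleCat.{u} R) → ModuleCat.{u} R
  | 0, W => W 0
  | s + 1, W => TT s (fun i => ModuleCat.of R (W i × W (i + 1)))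

lemma θ_equiv (n : ℕ) (l : List R) : ∀ (M : Type u) [AddCommGroup M] [Module R M]
    [Module.Finite R M] (h : FR J l M) (_ : ∀ a ∈ l, a ∈ J ^ n * J ^ n)
    (_ : ∀ i < l.length, Kills J n i M) (U : Submodule R (H J l.length M))
    (_ : ∀ u ∈ U, ∀ r ∈ J ^ n, r • u = 0) (W : ℕ → ModuleCat.{u} R)
    (_ : ∀ i < l.length, Nonempty (W i ≃ₗ[R] H J i M)) (_ : Nonempty (W l.length ≃ₗ[R] U)),
    Nonempty (U.comap (θ J l M h) ≃ₗ[R] TT l.length W) := by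
  induction l with
  | nil => 
    intro M _ _ _ h _ _ U _ W _ hW
    obtain ⟨e⟩ := hW
    exact ⟨e.symm⟩
  | cons a l ih =>
    intro M _ _ _ h hl hk U hU W hW hWU
    have ha := hl a List.mem_cons_self
    have hk0 : Kills J n l.length M := hk _ (by simp)
    obtain ⟨e⟩ := splitting J n ha h.1 l.length hk0 U hU
    obtain ⟨eU⟩ := hWU
    obtain ⟨e0⟩ := hW l.length (by simp)
    refine ih (q a M) h.2 (fun b hb => hl b (List.mem_cons_of_mem _ hb))
      (fun i hi => Kills_q J n ha h.1 i (hk i (by simp; omega))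
        (hk (i + 1) (by simp; omega))) (U.comap (genδ J l.length (texA h.1))) ?_
      (fun i => ModuleCat.of R (W i × W (i + 1))) ?_ ?_
    · intro u hu r hr
      have h1 : r • (⟨u, hu⟩ : Submodule.comap (genδ J l.length (texA h.1)) U) = 0 := by
        apply e.injective
        rw [map_smul, map_zero]
        exact Prod.ext (hk0 r hr _) (Subtype.ext (hU _ (Subtype.prop _) r hr))
      exact congrArg Subtype.val h1
    · intro i hi
      obtain ⟨e1⟩ := hW i (by simp; omega)
      obtain ⟨e2⟩ := hW (i + 1) (by simp; omega)
      obtain ⟨e3⟩ := splitting J n ha h.1 i (hk i (by simp; omega)) ⊤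
        (fun u _ r hr => hk (i + 1) (by simp; omega) r hr u)
      exact ⟨(((LinearEquiv.prodCongr e1 (e2.trans Submodule.topEquiv.symm)).trans e3.symm).trans
        Submodule.topEquiv)⟩
    · exact ⟨(LinearEquiv.prodCongr e0 eU).trans e.symm⟩

end theta
end LC

namespace LC

section comb

variable {R : Type u} [CommRing R]

lemma TT_pi (s : ℕ) : ∃ (K : Type) (_ : Finite K) (d : K → ℕ),
    (∀ i, Nat.card {k // d k = i} = s.choose i) ∧
    ∀ W : ℕ → ModuleCat.{u} R, Nonempty (TT s W ≃ₗ[R] Π k, W (d k)) := by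
  induction s with
  | zero => 
    refine ⟨Unit, inferInstance, fun _ => 0, fun i => ?_, fun W => ?_⟩
    · cases i with
      | zero => simp
      | succ i => simp
    · exact ⟨(LinearEquiv.funUnique Unit R (W 0)).symm⟩
  | succ s ih =>
    obtain ⟨K, _, d, h1, h2⟩ := ih
    refine ⟨K ⊕ K, inferInstance, Sum.elim d (fun k => d k + 1), fun i => ?_, fun W => ?_⟩
    · rw [Nat.card_congr Equiv.subtypeSum, Nat.card_sum]
      simp only [Sum.elim_inl, Sum.elim_inr]
      rw [h1 i]
      cases i with
      | zero => simp
      | succ i => 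
        simp only [Nat.add_right_cancel_iff]
        rw [h1 i, Nat.choose_succ_succ, add_comm]
    · obtain ⟨e⟩ := h2 (fun i => ModuleCat.of R (W i × W (i + 1)))
      let e' : (Π k, ModuleCat.of R (W (d k) × W (d k + 1))) ≃ₗ[R]
          Π k : K ⊕ K, W (Sum.elim d (fun k => d k + 1) k) :=
        { toFun := fun φ k => match k with
            | Sum.inl k => (φ k).1
            | Sum.inr k => (φ k).2
          invFun := fun φ k => (φ (Sum.inl k), φ (Sum.inr k))
          map_add' := by
            intro φ ψ; ext k; cases k <;> rfl
          map_smul' := by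
            intro φ ψ; ext k; cases k <;> rfl
          left_inv := by intro φ; rfl
          right_inv := by
            intro φ; ext k; cases k <;> rfl }
      exact ⟨e.trans e'⟩

lemma regroup (W L : ℕ → ModuleCat.{u} R) (t : ℕ) (hW : ∀ i < t, Nonempty (W i ≃ₗ[R] L i))
    (hW' : ∀ i, t ≤ i → Subsingleton (W i)) (K : Type) [Finite K] (d : K → ℕ)
    (hd : ∀ i, Nat.card {k // d k = i} = t.choose i) :
    Nonempty ((Π k, W (d k)) ≃ₗ[R] Π i : Fin t, Fin (t.choose i) → L i) := by
  have he : ∀ i, Nonempty ({k // d k = i} ≃ Fin (t.choose i)) := fun i => by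
    rw [← hd i]; exact ⟨Finite.equivFin _⟩
  have e := fun i => (he i).some
  have hc : ∀ (k : K) (i : ℕ) (h : d k = i) (hi : i < t), Nonempty (W (d k) ≃ₗ[R] L i) := by
    rintro k _ rfl hi
    exact hW _ hi
  have c := fun k i h hi => (hc k i h hi).some
  let Φ : (Π k, W (d k)) →ₗ[R] Π i : Fin t, Fin (t.choose i) → L i :=
    { toFun := fun φ i j => c ((e i).symm j).1 i ((e i).symm j).2 i.2 (φ ((e i).symm j).1)
      map_add' := by
        intro φ ψ; ext i j; simp
      map_smul' := by
        intro r φ; ext i j; simp }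
  refine ⟨LinearEquiv.ofBijective Φ ⟨?_, ?_⟩⟩
  · rw [injective_iff_map_eq_zero]
    intro φ hφ
    ext k
    by_cases hk : d k < t
    · have h1 : ∀ p : {k' // d k' = d k}, φ p.1 = 0 := by
        intro p
        obtain ⟨j, rfl⟩ := (e (d k)).symm.surjective p
        have := congrFun (congrFun hφ ⟨d k, hk⟩) j
        exact (LinearEquiv.map_eq_zero_iff _).1 this
      exact h1 ⟨k, rfl⟩
    · have := hW' (d k) (by omega)
      exact Subsingleton.elim _ _
  · intro ψ
    let φ : Π k, W (d k) := fun k =>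
      if h : d k < t then (c k (d k) rfl h).symm (ψ ⟨d k, h⟩ (e (d k) ⟨k, rfl⟩)) else 0
    refine ⟨φ, ?_⟩
    have h1 : ∀ (i : ℕ) (hi : i < t) (p : {k // d k = i}),
        c p.1 i p.2 hi (φ p.1) = ψ ⟨i, hi⟩ (e i p) := by
      rintro i hi ⟨k, rfl⟩
      simp [φ, hi]
    ext i j
    refine (h1 i i.2 ((e i).symm j)).trans ?_
    rw [Equiv.apply_symm_apply]

end comb

section final

variable {R : Type u} [CommRing R] (J : Ideal R)

lemma mem_q (a : R) (I : Ideal R) {M : Type u} [AddCommGroup M] [Module R M] (m : M) :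
    (aM a M).mkQ m ∈ (I • ⊤ : Submodule R (q a M)) ↔
      m ∈ ((Ideal.span {a} ⊔ I) • ⊤ : Submodule R M) := by
  have h1 : (I • ⊤ : Submodule R (q a M)) = Submodule.map (aM a M).mkQ (I • ⊤) := by
    rw [Submodule.map_smul'', Submodule.map_top, Submodule.range_mkQ]
  have h2 : aM a M = Ideal.span {a} • ⊤ := by
    ext y
    rw [mem_aM, Submodule.ideal_span_singleton_smul, Submodule.mem_smul_pointwise_iff_exists]
    simp
  rw [h1, ← Submodule.mem_comap, Submodule.comap_map_mkQ, Submodule.sup_smul, h2]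

lemma FR_of (t : ℕ) : ∀ (x : Fin t → R) (M : Type u) [AddCommGroup M] [Module R M],
    IsFilterRegularSeq J M x → FR J (List.ofFn x) M := by
  induction t with
  | zero => intro x M _ _ _; rw [List.ofFn_zero]; trivial
  | succ t ih =>
    intro x M _ _ h
    rw [List.ofFn_succ]
    refine ⟨fun m hm => ?_, ih _ _ ?_⟩
    · have := h 0 m (by rw [hm]; exact zero_mem _)
      simpa [IsTor] using this
    · have himg : ∀ i : Fin t, Ideal.span (x '' {j | j < i.succ}) =
          Ideal.span {x 0} ⊔ Ideal.span ((fun i => x i.succ) '' {j | j < i}) := by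
        intro i
        rw [← Ideal.span_insert]
        congr 1
        ext r
        simp only [Set.mem_image, Set.mem_ofPred_eq, Set.mem_insert_iff]
        constructor
        · rintro ⟨j, hj, rfl⟩
          refine Fin.cases (fun _ => Or.inl rfl) (fun j hj => Or.inr ⟨j, ?_, rfl⟩) j hj
          exact Fin.succ_lt_succ_iff.1 hj
        · rintro (rfl | ⟨j, hj, rfl⟩)
          · exact ⟨0, Fin.succ_pos i, rfl⟩
          · exact ⟨j.succ, Fin.succ_lt_succ_iff.2 hj, rfl⟩
      intro i m hm
      obtain ⟨m, rfl⟩ := Submodule.mkQ_surjective _ m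
      rw [← map_smul, mem_q, ← himg] at hm
      obtain ⟨n, hn⟩ := h i.succ m hm
      refine ⟨n, fun r hr => ?_⟩
      rw [← map_smul, mem_q, ← himg]
      exact hn r hr

lemma ofList_pow {t : ℕ} (x : Fin t → R) (n : ℕ) :
    Ideal.ofList ((List.ofFn x).map (· ^ n)) = Ideal.span (Set.range fun i => x i ^ n) := by
  rw [List.map_ofFn, Ideal.ofList]
  congr 1
  ext r
  simp [List.mem_ofFn]

lemma ofList_ofFn {t : ℕ} (x : Fin t → R) :
    Ideal.ofList (List.ofFn x) = Ideal.span (Set.range x) := by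
  rw [Ideal.ofList]
  congr 1
  ext r
  simp [List.mem_ofFn]

variable [IsNoetherianRing R]

lemma mu_mu (n m : ℕ) (l : List R) (M : Type u) [AddCommGroup M] [Module R M]
    [Module.Finite R M] (h : FR J l M) (hl : ∀ a ∈ l, a ∈ J ^ n * J ^ n)
    (hk : ∀ i < l.length, Kills J n i M) (y : Q l M) (hy : mu m l M y = 0) : mu 1 l M y = 0 := by
  obtain ⟨z, rfl⟩ := Hev_surj J y (mu_tor J m l M h y hy)
  rw [← Hev_nat] at hy ⊢
  rw [θ_mu J n l M h hl hk z (mu_θ J m l M h z (Hev_inj J _ hy)), map_zero]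

lemma ker_equiv (n : ℕ) (l : List R) (M : Type u) [AddCommGroup M] [Module R M]
    [Module.Finite R M] (h : FR J l M) (hl : ∀ a ∈ l, a ∈ J ^ n * J ^ n)
    (hk : ∀ i < l.length, Kills J n i M) :
    Nonempty ((⊥ : Submodule R (H J l.length M)).comap (θ J l M h) ≃ₗ[R] LinearMap.ker (mu 1 l M)) := by
  have hm : ∀ y ∈ (⊥ : Submodule R (H J l.length M)).comap (θ J l M h),
      Hev J y ∈ LinearMap.ker (mu 1 l M) := by
    intro y hy
    rw [LinearMap.mem_ker, ← Hev_nat, θ_mu J n l M h hl hk y hy, map_zero]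
  refine ⟨LinearEquiv.ofBijective ((Hev J).restrict hm) ⟨?_, ?_⟩⟩
  · rw [injective_iff_map_eq_zero]
    rintro ⟨y, hy⟩ h0
    exact Subtype.ext (Hev_inj J y (congrArg Subtype.val h0))
  · rintro ⟨y, hy⟩
    obtain ⟨z, rfl⟩ := Hev_surj J y (mu_tor J 1 l M h y hy)
    rw [LinearMap.mem_ker, ← Hev_nat] at hy
    exact ⟨⟨z, mu_θ J 1 l M h z (Hev_inj J _ hy)⟩, rfl⟩

lemma main {M : Type u} [AddCommGroup M] [Module R M] [Module.Finite R M] (t n : ℕ)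
    (hann : ∀ j < t, ∀ (a : lcoh J j M), ∀ r ∈ J ^ n, r • a = 0)
    (x : Fin t → R) (hfr : IsFilterRegularSeq J M x) (hx : ∀ i, x i ∈ J ^ (2 * n)) :
    Nonempty ((↥(limitClosure x M) ⧸
        ((Ideal.span (Set.range x) • (⊤ : Submodule R M)).comap (limitClosure x M).subtype))
      ≃ₗ[R] Π i : Fin t, Fin (t.choose i) → lcoh J i M) := by
  have hFR := FR_of J t x M hfr
  have hkill : ∀ i < t, Kills J n i M := by
    intro i hi r hr z
    apply (Hcmp J i M).injective
    rw [map_smul, map_zero]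
    exact hann i hi _ r hr
  have hlen : (List.ofFn x).length = t := List.length_ofFn
  have hprod : (List.ofFn x).prod = ∏ i, x i := List.prod_ofFn
  have hmem : ∀ a ∈ List.ofFn x, a ∈ J ^ n * J ^ n := by
    intro a ha
    obtain ⟨i, rfl⟩ := (List.mem_ofFn' _ _).1 ha
    rw [← pow_add, ← two_mul]; exact hx i
  have hmu : ∀ m (y : M), mu (m + 1) (List.ofFn x) M (pr _ M y) = 0 ↔
      (∏ i, x i) ^ (m + 1) • y ∈
        (Ideal.span (Set.range fun i => x i ^ (m + 2)) • (⊤ : Submodule R M)) := by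
    intro m y
    rw [mu_pr, pr_ker, ofList_pow, hprod]
  have hpr : ∀ y : M, pr (List.ofFn x) M y = 0 ↔
      y ∈ (Ideal.span (Set.range x) • (⊤ : Submodule R M)) := by
    intro y
    rw [pr_ker, ofList_ofFn]
  generalize hl : List.ofFn x = l at *
  have hkill' : ∀ i < l.length, Kills J n i M := by rw [hlen]; exact hkill
  have hlim : ∀ y : M, y ∈ limitClosure x M ↔ mu 1 l M (pr l M y) = 0 := by
    intro y
    constructor
    · intro hy
      have hle : limitClosure x M ≤ LinearMap.ker (mu 1 l M ∘ₗ pr l M) := by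
        refine iSup_le fun m z hz => ?_
        exact mu_mu J n (m + 1) l M hFR hmem hkill' _ ((hmu m z).2 hz)
      exact hle hy
    · intro hy
      exact (le_iSup (fun n : ℕ => (Ideal.span (Set.range fun i => x i ^ (n + 2)) •
        (⊤ : Submodule R M)).comap ((∏ i, x i) ^ (n + 1) • (LinearMap.id : M →ₗ[R] M))) 0)
        ((hmu 0 y).1 hy)
  obtain ⟨e1⟩ : Nonempty ((↥(limitClosure x M) ⧸
        ((Ideal.span (Set.range x) • (⊤ : Submodule R M)).comap (limitClosure x M).subtype))
      ≃ₗ[R] LinearMap.ker (mu 1 l M)) := by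
    refine equiv_of_ker (Submodule.mkQ _) ((pr l M).restrict (p := limitClosure x M)
      (q := LinearMap.ker (mu 1 l M)) (fun y hy => (hlim y).1 hy)) (Submodule.mkQ_surjective _) ?_ ?_
    · rintro ⟨z, hz⟩
      obtain ⟨y, rfl⟩ := pr_surj l M z
      exact ⟨⟨y, (hlim y).2 hz⟩, rfl⟩
    · rintro ⟨y, hy⟩
      rw [Submodule.mkQ_apply, Submodule.Quotient.mk_eq_zero, Submodule.mem_comap, 
        Submodule.subtype_apply, ← hpr]
      exact ⟨fun h => Subtype.ext h, fun h => congrArg Subtype.val h⟩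
  obtain ⟨e2⟩ := ker_equiv J n l M hFR hmem hkill'
  obtain ⟨W, hW, hW'⟩ : ∃ W : ℕ → ModuleCat.{u} R,
      (∀ i < t, W i = lcoh J i M) ∧ (∀ i, t ≤ i → W i = ModuleCat.of R PUnit) :=
    ⟨fun i => if i < t then lcoh J i M else ModuleCat.of R PUnit, fun i hi => if_pos hi,
      fun i hi => if_neg (by omega)⟩
  obtain ⟨e3⟩ := θ_equiv J n l M hFR hmem hkill' ⊥ (by
    intro u hu r _
    rw [(Submodule.mem_bot R).1 hu, smul_zero]) W (by
    intro i hi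
    rw [hW i (by omega)]
    exact ⟨(Hcmp J i M).symm⟩) (by
    rw [hW' _ hlen.ge]
    exact ⟨LinearEquiv.ofSubsingleton _ _⟩)
  obtain ⟨K, _, d, hd, hT⟩ := TT_pi (R := R) l.length
  obtain ⟨e4⟩ := hT W
  rw [hlen] at hd
  obtain ⟨e5⟩ := regroup W (fun i => lcoh J i M) t (fun i hi => by
    rw [hW i hi]; exact ⟨LinearEquiv.refl _ _⟩) (fun i hi => by
    rw [hW' i hi]; exact inferInstanceAs (Subsingleton PUnit)) K d hd
  exact ⟨e1.trans (e2.symm.trans (e3.trans (e4.trans e5)))⟩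

end final
end LC

/-- if `M` has positive finiteness dimension `t` and
`𝔪^{n₀} H^j_𝔪(M) = 0` for all `j < t`, then for every filter regular sequence
`x_1,…,x_t` on `M` contained in `𝔪^{2n₀}`,
`(x_1,…,x_t)^{lim}_M / (x_1,…,x_t)M ≅ ⊕_{i=0}^{t-1} H^i_𝔪(M)^{C(t,i)}`. -/
theorem limitClosure_quotient_splitting
    {R : Type u} [CommRing R] [IsNoetherianRing R] [IsLocalRing R]
    (M : Type u) [AddCommGroup M] [Module R M] [Module.Finite R M]
    (t n₀ : ℕ)
    (ht : sInf {i | ¬ Module.Finite R (lcoh (maximalIdeal R) i M)} = t) (ht0 : 0 < t)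
    (hn₀ : 1 ≤ n₀)
    (hann : ∀ j < t, ∀ (a : lcoh (maximalIdeal R) j M),
      ∀ r ∈ maximalIdeal R ^ n₀, r • a = 0)
    (x : Fin t → R) (hfr : IsFilterRegularSeq (maximalIdeal R) M x)
    (hx : ∀ i, x i ∈ maximalIdeal R ^ (2 * n₀)) :
    Nonempty ((↥(limitClosure x M) ⧸
        ((Ideal.span (Set.range x) • (⊤ : Submodule R M)).comap (limitClosure x M).subtype))
      ≃ₗ[R] Π i : Fin t, Fin (t.choose i) → lcoh (maximalIdeal R) i M) := by
  exact LC.main (maximalIdeal R) t n₀ hann x hfr hx
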